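/- The total number of regular subgroups of Perm(S₆) normalized by λ(S₆) is 224; equivalently, #E(S₆) = 224. -/

import Mathlib

/-- A subgroup `H` of `Perm G` is regular if the evaluation map `η ↦ η 1` is bijective. -/
def IsRegularSubgroup {G : Type*} [Group G] (H : Subgroup (Equiv.Perm G)) : Prop :=
  Function.Bijective fun η : H => (η : Equiv.Perm G) 1

/-- A subgroup `H` of `Perm G` is normalized by the image `λ(G)` of the left regular
representation. -/
def IsNormalizedByLeft {G : Type*} [Group G] (H : Subgroup (Equiv.Perm G)) : Prop :=
  ∀ σ : G, ∀ η ∈ H, Equiv.mulLeft σ * η * (Equiv.mulLeft σ)⁻¹ ∈ H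


structure Cfg (A N : Type) [Group A] [Group N] where
  la : A →* MulAut N
  c : A → N
  inj : Function.Injective la
  cinj : Function.Injective c
  coc : ∀ a b, c (a * b) = c a * la a (c b)
  cardA : Nat.card A = 360
  cardN : Nat.card N = 720
  simple : IsSimpleGroup A
  nc : ∃ a b : A, a * b ≠ b * a

theorem perf_triv {A M : Type} [Group A] [Monoid M] (hs : IsSimpleGroup A)
    (nc : ∃ a b : A, a * b ≠ b * a) (f : A →* M) (hf : ∀ a b, f a * f b = f b * f a) (a : A) :
    f a = 1 := by
  obtain ⟨x, y, hxy⟩ := nc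
  have hn : f.ker.Normal := inferInstance
  rcases hs.eq_bot_or_eq_top_of_normal f.ker hn with h | h
  · exfalso
    apply hxy
    have h1 : x * y * x⁻¹ * y⁻¹ ∈ f.ker := by
      rw [MonoidHom.mem_ker, map_mul, map_mul, map_mul, mul_assoc (f x), hf y x⁻¹, ← mul_assoc,
        ← map_mul, mul_inv_cancel, map_one, one_mul, ← map_mul, mul_inv_cancel, map_one]
    rw [h, Subgroup.mem_bot] at h1
    rw [mul_inv_eq_one, mul_inv_eq_iff_eq_mul] at h1
    exact h1
  · have : a ∈ f.ker := by rw [h]; trivial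
    exact this

theorem cyc_triv {A M : Type} [Group A] [Group M] [IsCyclic M] (hs : IsSimpleGroup A)
    (nc : ∃ a b : A, a * b ≠ b * a) (e : A →* Monoid.End M) (a : A) : e a = 1 := by
  refine perf_triv hs nc e ?_ a
  intro a b
  obtain ⟨i, hi⟩ := MonoidHom.map_cyclic (G := M) (e a)
  obtain ⟨j, hj⟩ := MonoidHom.map_cyclic (G := M) (e b)
  apply MonoidHom.ext
  intro x
  change e a (e b x) = e b (e a x)
  erw [hj, hi, hi, hj]
  rw [← zpow_mul, ← zpow_mul, mul_comm]

theorem inj_or_triv {A H : Type} [Group A] [Group H] (hs : IsSimpleGroup A) (f : A →* H) :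
    Function.Injective f ∨ ∀ a, f a = 1 := by
  have hn : f.ker.Normal := inferInstance
  rcases hs.eq_bot_or_eq_top_of_normal f.ker hn with h | h
  · left; exact (MonoidHom.ker_eq_bot_iff f).1 h
  · right; intro a
    have : a ∈ f.ker := by rw [h]; trivial
    exact this

theorem fix5 {α : Type} [Finite α] (f : Equiv.Perm α) (h5 : f ^ 5 = 1) (hc : Nat.card α ≤ 5)
    (a : α) (ha : f a = a) : ∀ b, f b = b := by
  classical
  have := Fintype.ofFinite α
  have hp : Fact (Nat.Prime 5) := ⟨by norm_num⟩
  let F : Function.End α := ⇑f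
  have hF : F ^ 5 ^ 1 = 1 := by
    have := congrArg (fun g : Equiv.Perm α => (⇑g : α → α)) h5
    rw [pow_one]
    funext x
    have := congrFun this x
    simp only [pow_succ, pow_zero, one_mul, Equiv.Perm.mul_apply] at this
    exact this
  have key : Fintype.card α ≡ Fintype.card (Function.fixedPoints (⇑f : α → α)) [MOD 5] :=
    Equiv.Perm.card_fixedPoints_modEq (f := F) (p := 5) (n := 1) hF
  rw [Nat.card_eq_fintype_card] at hc
  have h1 : 0 < Fintype.card (Function.fixedPoints (⇑f : α → α)) :=
    Fintype.card_pos_iff.2 ⟨⟨a, ha⟩⟩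
  have h2 : Fintype.card (Function.fixedPoints (⇑f : α → α)) ≤ Fintype.card α :=
    Fintype.card_subtype_le _
  have h3 : Fintype.card (Function.fixedPoints (⇑f : α → α)) = Fintype.card α := by
    unfold Nat.ModEq at key
    omega
  intro b
  by_contra hb
  have : Fintype.card (Function.fixedPoints (⇑f : α → α)) < Fintype.card α :=
    Fintype.card_subtype_lt (p := fun x => x ∈ Function.fixedPoints (⇑f : α → α)) (x := b) hb
  omega

/-- an automorphism preserving a subgroup, of order dividing 5, on a small subgroup -/
theorem fix5_sub {N : Type} [Group N] [Finite N] (h : MulAut N) (h5 : h ^ 5 = 1) (Q : Subgroup N)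
    (hc : Nat.card Q ≤ 5) (hQ : ∀ x ∈ Q, h x ∈ Q) : ∀ x ∈ Q, h x = x := by
  have hinj : Function.Injective (fun x : Q => (⟨h x, hQ x x.2⟩ : Q)) := by
    intro x y hxy
    have := congrArg Subtype.val hxy
    exact Subtype.ext (h.injective this)
  let f : Equiv.Perm Q := Equiv.ofBijective _ (Finite.injective_iff_bijective.1 hinj)
  have hf : ∀ (n : ℕ) (x : Q), (((f ^ n) x : Q) : N) = (h ^ n) (x : N) := by
    intro n
    induction n with
    | zero => intro x; rfl
    | succ n ih => intro x; rw [pow_succ, pow_succ, Equiv.Perm.mul_apply, ih]; rfl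
  have h5' : f ^ 5 = 1 := by
    ext x
    rw [hf, h5]; rfl
  intro x hx
  have := fix5 f h5' hc 1 (Subtype.ext (map_one h)) ⟨x, hx⟩
  exact congrArg Subtype.val this

namespace Cfg
variable {A N : Type} [Group A] [Group N]

theorem finN (C : Cfg A N) : Finite N := Nat.finite_of_card_ne_zero (by rw [C.cardN]; norm_num)

theorem finA (C : Cfg A N) : Finite A := Nat.finite_of_card_ne_zero (by rw [C.cardA]; norm_num)

/-- two-element kernels -/
theorem small_fix (K : Subgroup N) (hK : Nat.card K ≤ 2) [Finite N] (b : MulAut N)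
    (hb : ∀ x ∈ K, b x ∈ K) : ∀ x ∈ K, b x = x := by
  intro x hx
  by_cases h1 : x = 1
  · rw [h1, map_one]
  by_contra h2
  have h3 : b x ≠ 1 := by simpa using h1
  classical
  have : Fintype K := Fintype.ofFinite K
  rw [Nat.card_eq_fintype_card] at hK
  have := Finset.card_le_univ ({1, ⟨x, hx⟩, ⟨b x, hb x hx⟩} : Finset K)
  have h4 : ({1, ⟨x, hx⟩, ⟨b x, hb x hx⟩} : Finset K).card = 3 := by
    refine Finset.card_eq_three.2 ⟨1, ⟨x, hx⟩, ⟨b x, hb x hx⟩, ?_, ?_, ?_, rfl⟩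
    · intro h; exact h1 (congrArg Subtype.val h).symm
    · intro h; exact h3 (congrArg Subtype.val h).symm
    · intro h; exact h2 (congrArg Subtype.val h).symm
  omega

theorem small_comm (K : Subgroup N) (hK : Nat.card K ≤ 2) [Finite N] (x y : N) (hx : x ∈ K)
    (hy : y ∈ K) : x * y = y * x := by
  have := small_fix K hK (MulAut.conj x) (fun z hz => by
    simpa using K.mul_mem (K.mul_mem hx hz) (K.inv_mem hx)) y hy
  rw [MulAut.conj_apply, mul_inv_eq_iff_eq_mul] at this
  exact this

theorem L1 (C : Cfg A N) {H : Type} [Group H] (f : N →* H) (hf : ∀ a n, f (C.la a n) = f n) (a : A) :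
    f (C.c a) = 1 := by
  have := C.finN
  have := C.finA
  let g : A →* H := MonoidHom.mk' (fun a => f (C.c a)) (fun a b => by
    rw [C.coc, map_mul, hf])
  rcases inj_or_triv C.simple g with h | h
  swap
  · exact h a
  exfalso
  have hK : Nat.card f.ker ≤ 2 := by
    have h1 : Nat.card A ≤ Nat.card f.range := by
      have hg : ∀ a, g a ∈ f.range := fun a => ⟨C.c a, rfl⟩
      have : Finite f.range := Finite.of_surjective f.rangeRestrict f.rangeRestrict_surjective
      exact Nat.card_le_card_of_injective (fun a => (⟨g a, hg a⟩ : f.range))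
        (fun x y hxy => h (congrArg Subtype.val hxy))
    have h2 := Subgroup.card_mul_index f.ker
    rw [Subgroup.index_ker, C.cardN] at h2
    rw [C.cardA] at h1
    nlinarith
  have hd : ∀ a n, C.la a n * n⁻¹ ∈ f.ker := by
    intro a n
    rw [MonoidHom.mem_ker, map_mul, hf, map_inv, mul_inv_cancel]
  have htriv : ∀ a n, C.la a n = n := by
    intro a n
    have hfix : ∀ a, ∀ x ∈ f.ker, C.la a x = x := fun a => small_fix f.ker hK (C.la a) (by
      intro x hx; rw [MonoidHom.mem_ker, hf]; exact hx)
    let d : A →* N := MonoidHom.mk' (fun a => C.la a n * n⁻¹) (fun a b => by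
      have h1 : C.la (a * b) n = C.la a (C.la b n * n⁻¹ * n) := by
        rw [inv_mul_cancel_right, map_mul]; rfl
      rw [h1, map_mul, hfix a _ (hd b n), mul_assoc]
      exact small_comm f.ker hK _ _ (hd b n) (hd a n))
    have := perf_triv C.simple C.nc d (fun a b => small_comm f.ker hK _ _ (hd a n) (hd b n)) a
    exact mul_inv_eq_one.1 this
  obtain ⟨x, y, hxy⟩ := C.nc
  apply hxy
  apply C.inj
  ext n
  rw [htriv, htriv]

theorem L2 (C : Cfg A N) (O : Subgroup N) [O.Normal] (hO : ∀ a, ∀ x ∈ O, C.la a x = x) (a : A) :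
    C.c a ∈ Subgroup.centralizer (O : Set N) := by
  have := C.L1 (MulAut.conjNormal (H := O)) (by
    intro a n
    ext x
    rw [MulAut.conjNormal_apply, MulAut.conjNormal_apply]
    have h1 := hO a (n * x * n⁻¹) (Subgroup.Normal.conj_mem ‹_› _ x.2 n)
    rw [map_mul, map_mul, hO a x x.2, map_inv] at h1
    exact h1) a
  rw [Subgroup.mem_centralizer_iff]
  intro x hx
  have h2 := congrArg (fun g : MulAut O => ((g ⟨x, hx⟩ : O) : N)) this
  simp only [MulAut.conjNormal_apply] at h2
  exact (mul_inv_eq_iff_eq_mul.1 h2).symm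

theorem cardQ (C : Cfg A N) (Q : Sylow 5 N) : Nat.card Q = 5 := by
  have := C.finN
  have hp : Fact (Nat.Prime 5) := ⟨by norm_num⟩
  rw [Q.card_eq_multiplicity, C.cardN]
  have : Nat.factorization 720 5 = 1 := by
    rw [Nat.factorization_def _ (by norm_num)]
    rw [show 720 = 5 * 144 by norm_num, padicValNat.mul (by norm_num) (by norm_num)]
    rw [padicValNat.self (by norm_num), padicValNat.eq_zero_of_not_dvd (by norm_num)]
  rw [this, pow_one]

open scoped IsMulCommutative in
theorem central_pow {M : Type} [Group M] [Finite M] (H : Subgroup M) (hH : H ≤ Subgroup.center M)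
    (x y : M) : (x * y) ^ H.index = x ^ H.index * y ^ H.index ∧ x ^ H.index ∈ H := by
  have key : ∀ g : M, ∀ (k : ℕ) (g₀ : M), g₀⁻¹ * g ^ k * g₀ ∈ H → g₀⁻¹ * g ^ k * g₀ = g ^ k := by
    intro g k g₀ hk
    have h1 := Subgroup.mem_center_iff.1 (hH hk) g₀
    rw [← mul_assoc, ← mul_assoc, mul_inv_cancel, one_mul] at h1
    have h2 := mul_right_cancel h1
    exact h2.symm
  have e := fun g => MonoidHom.transfer_eq_pow (Subgroup.inclusion hH) g (key g)
  refine ⟨?_, MonoidHom.transfer_eq_pow_aux x (key x)⟩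
  have h3 := map_mul (MonoidHom.transfer (Subgroup.inclusion hH)) x y
  rw [e, e, e] at h3
  exact congrArg Subtype.val h3

theorem kk (C : Cfg A N) (Q : Sylow 5 N)
    (h : ∀ a, ∀ x ∈ Subgroup.normalClosure (Q : Set N), C.la a x = x) :
    False := by
  have := C.finN
  have := C.finA
  have hp : Fact (Nat.Prime 5) := ⟨by norm_num⟩
  have hQO : ∀ x ∈ Q, x ∈ Subgroup.normalClosure (Q : Set N) :=
    fun x hx => Subgroup.subset_normalClosure hx
  have hc := C.L2 _ h
  set Z := Subgroup.centralizer (Q : Set N) with hZ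
  have hcZ : ∀ a, C.c a ∈ Z := fun a =>
    Subgroup.centralizer_le (fun x hx => hQO x hx) (hc a)
  have hQZ : (Q : Subgroup N) ≤ Z := by
    have hcyc : IsCyclic Q := isCyclic_of_prime_card (C.cardQ Q)
    intro x hx
    rw [hZ, Subgroup.mem_centralizer_iff]
    intro y hy
    exact congrArg Subtype.val (hcyc.isMulCommutative.is_comm.comm (⟨y, hy⟩ : Q) ⟨x, hx⟩)
  let H : Subgroup Z := (Q : Subgroup N).subgroupOf Z
  have hH : H ≤ Subgroup.center Z := by
    intro x hx
    rw [Subgroup.mem_center_iff]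
    intro g
    have := Subgroup.mem_centralizer_iff.1 g.2 x hx
    exact Subtype.ext this.symm
  have hcp := central_pow H hH
  have hfix : ∀ a, ∀ x ∈ Q, C.la a x = x := fun a x hx => h a x (hQO x hx)
  set m := H.index with hm
  have hlaZ : ∀ a, ∀ x ∈ Z, C.la a x ∈ Z := by
    intro a x hx
    rw [hZ, Subgroup.mem_centralizer_iff]
    intro y hy
    rw [← hfix a y hy, ← map_mul, ← map_mul, Subgroup.mem_centralizer_iff.1 hx y hy]
  have hpQ : ∀ x ∈ Z, x ^ m ∈ Q := fun x hx => (hcp ⟨x, hx⟩ 1).2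
  have hmul : ∀ x ∈ Z, ∀ y ∈ Z, (x * y) ^ m = x ^ m * y ^ m := fun x hx y hy =>
    congrArg Subtype.val (hcp ⟨x, hx⟩ ⟨y, hy⟩).1
  let d : A →* N := MonoidHom.mk' (fun a => C.c a ^ m) (fun a b => by
    rw [C.coc, hmul _ (hcZ a) _ (hlaZ a _ (hcZ b)), ← map_pow, hfix a _ (hpQ _ (hcZ b))])
  have hd : ∀ a, C.c a ^ m = 1 := perf_triv C.simple C.nc d (fun a b =>
    (Subgroup.mem_centralizer_iff.1 (hQZ (hpQ _ (hcZ b))) _ (hpQ _ (hcZ a))))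
  let F : Z →* Z := MonoidHom.mk' (fun x => x ^ m) (fun x y => (hcp x y).1)
  have hker : 360 ≤ Nat.card F.ker := by
    rw [← C.cardA]
    exact Nat.card_le_card_of_injective
      (fun a => (⟨⟨C.c a, hcZ a⟩, Subtype.ext (hd a)⟩ : F.ker))
      (fun x y hxy => C.cinj (congrArg (fun z : F.ker => ((z : Z) : N)) hxy))
  have hcardH : Nat.card H = 5 := by
    rw [← C.cardQ Q]
    exact Nat.card_congr (Subgroup.subgroupOfEquivOfLe hQZ).toEquiv
  have hm5 : m * 5 = Nat.card Z := by
    rw [hm, ← hcardH, mul_comm]; exact Subgroup.card_mul_index H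
  have hZ720 : Nat.card Z ∣ 720 := C.cardN ▸ Subgroup.card_subgroup_dvd_card Z
  have hcop : ¬ 5 ∣ m := by
    rintro ⟨k, hk⟩
    rw [← hm5, hk] at hZ720
    have : 25 ∣ 720 := Dvd.dvd.trans ⟨k, by ring⟩ hZ720
    omega
  have hle : Nat.card F.ker ≤ m := by
    have hinj : Function.Injective (fun p : F.ker × H => (p.1 : Z) * (p.2 : Z)) := by
      rintro ⟨a, b⟩ ⟨a', b'⟩ hab
      have hab : (a : Z) * b = a' * b' := hab
      have h1 : F ((a : Z) * b) = F (a' * b') := by rw [hab]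
      rw [map_mul, map_mul, a.2, a'.2, one_mul, one_mul] at h1
      have h2 : (b : Z) = b' := by
        have h3 : ((b : Z) * (b' : Z)⁻¹) ^ m = 1 := by
          have : F ((b : Z) * (b' : Z)⁻¹) = 1 := by rw [map_mul, map_inv, h1, mul_inv_cancel]
          exact this
        have h4 : ((b : Z) * (b' : Z)⁻¹) ^ 5 = 1 := by
          have : (b * b'⁻¹) ^ (Nat.card H) = 1 := pow_card_eq_one'
          rw [hcardH] at this
          exact congrArg Subtype.val this
        have h5 : Nat.Coprime 5 m := (Nat.Prime.coprime_iff_not_dvd (by norm_num)).2 hcop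
        have h6 := pow_gcd_eq_one.2 ⟨h4, h3⟩
        rw [h5, pow_one] at h6
        exact mul_inv_eq_one.1 h6
      have h7 : (a : Z) = a' := by rw [h2] at hab; exact mul_right_cancel hab
      exact Prod.ext (Subtype.ext h7) (Subtype.ext h2)
    have := Nat.card_le_card_of_injective _ hinj
    rw [Nat.card_prod, hcardH, ← hm5] at this
    omega
  have : Nat.card Z ≤ 720 := Nat.le_of_dvd (by norm_num) hZ720
  omega

theorem L3 (C : Cfg A N) (Q : Sylow 5 N) (h : Subgroup.normalizer (Q : Set N) ≤ Subgroup.centralizer (Q : Set N)) :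
    False := by
  have := C.finN
  have hp : Fact (Nat.Prime 5) := ⟨by norm_num⟩
  set K := (MonoidHom.transferSylow Q h).ker with hK
  have hcomp := MonoidHom.ker_transferSylow_isComplement' Q h
  have hcard : Nat.card K * 5 = 720 := by
    rw [← C.cardN, ← hcomp.card_mul_card]
    congr 1
    exact (C.cardQ Q).symm
  have hcard : Nat.card K = 144 := by omega
  have hidx : K.index = 5 := by
    have := K.card_mul_index
    rw [hcard, C.cardN] at this
    omega
  have hmem : ∀ n, n ∈ K ↔ n ^ 144 = 1 := by
    intro n
    constructor
    · intro hn
      have : (⟨n, hn⟩ : K) ^ (Nat.card K) = 1 := pow_card_eq_one'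
      rw [hcard] at this
      exact congrArg Subtype.val this
    · intro hn
      rw [← QuotientGroup.eq_one_iff]
      have h1 : (n : N ⧸ K) ^ 144 = 1 := by rw [← QuotientGroup.mk_pow, hn]; rfl
      have h2 : (n : N ⧸ K) ^ 5 = 1 := by
        have : (n : N ⧸ K) ^ Nat.card (N ⧸ K) = 1 := pow_card_eq_one'
        rwa [← Subgroup.index, hidx] at this
      have := pow_gcd_eq_one.2 ⟨h1, h2⟩
      simpa using this
  have hcyc : IsCyclic (N ⧸ K) := isCyclic_of_prime_card (p := 5) hidx
  let e : A →* Monoid.End (N ⧸ K) :=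
    { toFun := fun a => QuotientGroup.map K K (C.la a).toMonoidHom (by
        intro n hn
        rw [Subgroup.mem_comap, hmem]
        rw [hmem] at hn
        change (C.la a n) ^ 144 = 1
        rw [← map_pow, hn, map_one])
      map_one' := by
        ext n
        obtain ⟨n, rfl⟩ := QuotientGroup.mk_surjective n
        have h1 : C.la 1 n = n := by rw [map_one]; rfl
        exact congrArg (QuotientGroup.mk (s := K)) h1
      map_mul' := by
        intro a b
        ext n
        obtain ⟨n, rfl⟩ := QuotientGroup.mk_surjective n
        have h1 : C.la (a * b) n = C.la a (C.la b n) := by rw [map_mul]; rfl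
        exact congrArg (QuotientGroup.mk (s := K)) h1 }
  have he := cyc_triv C.simple C.nc e
  have := C.L1 (QuotientGroup.mk' K) (by
    intro a n
    have := congrArg (fun f : Monoid.End (N ⧸ K) => f (QuotientGroup.mk' K n)) (he a)
    exact this)
  have h360 : 360 ≤ Nat.card K := by
    rw [← C.cardA]
    exact Nat.card_le_card_of_injective
      (fun a => (⟨C.c a, by simpa using this a⟩ : K))
      (fun x y hxy => C.cinj (congrArg Subtype.val hxy))
  omega
end Cfg

namespace Cfg
variable {A N : Type} [Group A] [Group N]

theorem conjRange_normal : (MulAut.conj (G := N)).range.Normal := by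
  constructor
  rintro _ ⟨n, rfl⟩ f
  refine ⟨f n, ?_⟩
  ext x
  simp [MulAut.mul_apply]

open scoped Pointwise in
theorem Oinv (C : Cfg A N) (Q : Sylow 5 N) (f : MulAut N) (x : N)
    (hx : x ∈ Subgroup.normalClosure (Q : Set N)) :
    f x ∈ Subgroup.normalClosure (Q : Set N) := by
  have := C.finN
  have hp : Fact (Nat.Prime 5) := ⟨by norm_num⟩
  have h : Subgroup.normalClosure (Q : Set N) ≤
      (Subgroup.normalClosure (Q : Set N)).comap f.toMonoidHom := by
    apply Subgroup.normalClosure_le_normal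
    intro q hq
    obtain ⟨g, hg⟩ := MulAction.exists_smul_eq N Q (f • Q)
    have h1 : f q ∈ f • Q := by
      have : f • q ∈ f • (Q : Subgroup N) := Subgroup.smul_mem_pointwise_smul q f _ hq
      exact this
    rw [← hg] at h1
    have h2 : f q ∈ MulAut.conj g • (Q : Subgroup N) := h1
    rw [Subgroup.mem_pointwise_smul_iff_inv_smul_mem] at h2
    have h3 := Subgroup.normalClosure_normal.conj_mem _
      (Subgroup.subset_normalClosure (s := (Q : Set N)) h2) g
    have h4 : g * (MulAut.conj g)⁻¹ • f q * g⁻¹ = f q := by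
      rw [← map_inv, MulAut.smul_def, MulAut.conj_apply]; group
    rw [h4] at h3
    exact h3
  exact h hx

theorem L4 (C : Cfg A N) (Q : Sylow 5 N) (a0 : A) (ha0 : a0 ≠ 1) (m0 : N)
    (h0 : ∀ x ∈ Subgroup.normalClosure (Q : Set N), C.la a0 x = m0 * x * m0⁻¹) :
    ∀ a, ∃ n, C.la a = MulAut.conj n := by
  have := C.finN
  have := C.finA
  set O := Subgroup.normalClosure (Q : Set N) with hO
  have hn : O.Normal := Subgroup.normalClosure_normal
  have hinv : ∀ (f : MulAut N), ∀ x ∈ O, f x ∈ O := C.Oinv Q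
  let S : Subgroup A :=
    { carrier := {a | ∃ m, ∀ x ∈ O, C.la a x = m * x * m⁻¹}
      one_mem' := ⟨1, fun x _ => by simp⟩
      mul_mem' := by
        rintro a b ⟨m, hm⟩ ⟨m', hm'⟩
        refine ⟨C.la a m' * m, fun x hx => ?_⟩
        rw [map_mul, MulAut.mul_apply, hm' x hx, map_mul, map_mul, hm x hx, map_inv]
        group
      inv_mem' := by
        rintro a ⟨m, hm⟩
        refine ⟨m⁻¹, fun x hx => ?_⟩
        have h1 := hm _ (hn.conj_mem x hx m⁻¹)
        rw [map_inv, MulAut.inv_apply, MulEquiv.symm_apply_eq, h1]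
        group }
  have hS : S.Normal := by
    constructor
    rintro a ⟨m, hm⟩ b
    refine ⟨C.la b m, fun x hx => ?_⟩
    rw [map_mul, map_mul, MulAut.mul_apply, MulAut.mul_apply, hm _ (hinv _ x hx), map_mul, map_mul,
      map_inv, map_inv, MulAut.apply_inv_self]
  have hST : S = ⊤ := by
    rcases C.simple.eq_bot_or_eq_top_of_normal S hS with h | h
    · exfalso
      have : a0 ∈ S := ⟨m0, h0⟩
      rw [h, Subgroup.mem_bot] at this
      exact ha0 this
    · exact h
  have hall : ∀ a, ∃ m, ∀ x ∈ O, C.la a x = m * x * m⁻¹ := fun a => by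
    have : a ∈ S := by rw [hST]; trivial
    exact this
  choose m hm using hall
  let T : Subgroup A :=
    { carrier := {a | ∀ x ∈ O, C.la a x = x}
      one_mem' := fun x _ => by simp
      mul_mem' := by
        intro a b ha hb x hx
        rw [map_mul, MulAut.mul_apply, hb x hx, ha x hx]
      inv_mem' := by
        intro a ha x hx
        rw [map_inv, MulAut.inv_apply, MulEquiv.symm_apply_eq, ha x hx] }
  have hT : T.Normal := by
    constructor
    intro a ha b x hx
    rw [map_mul, map_mul, MulAut.mul_apply, MulAut.mul_apply, ha _ (hinv _ x hx), map_inv,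
      MulAut.apply_inv_self]
  have hTb : T = ⊥ := by
    rcases C.simple.eq_bot_or_eq_top_of_normal T hT with h | h
    · exact h
    · exact (C.kk Q (fun a => by
        have : a ∈ T := by rw [h]; trivial
        exact this)).elim
  set K := Subgroup.centralizer (O : Set N) with hK
  have hK2 : Nat.card K ≤ 2 := by
    have hinj : Function.Injective (fun p : A × K => m p.1 * (p.2 : N)) := by
      rintro ⟨a, k⟩ ⟨b, l⟩ hab
      have hab : m a * (k : N) = m b * l := hab
      have hk : ∀ (k : K), ∀ x ∈ O, (k : N) * x * (k : N)⁻¹ = x := fun k x hx => by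
        rw [mul_inv_eq_iff_eq_mul]
        exact (Subgroup.mem_centralizer_iff.1 k.2 x hx).symm
      have hmk : ∀ a (k : K), ∀ x ∈ O, C.la a x = (m a * k) * x * (m a * k)⁻¹ := fun a k x hx => by
        conv_lhs => rw [hm a x hx, ← hk k x hx]
        group
      have h1 : b⁻¹ * a ∈ T := by
        intro x hx
        rw [map_mul, MulAut.mul_apply, map_inv, MulAut.inv_apply, MulEquiv.symm_apply_eq,
          hmk a k x hx, hab, ← hmk b l x hx]
      rw [hTb, Subgroup.mem_bot, inv_mul_eq_one] at h1
      subst h1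
      exact Prod.ext rfl (Subtype.ext (mul_left_cancel hab))
    have := Nat.card_le_card_of_injective _ hinj
    rw [Nat.card_prod, C.cardA, C.cardN] at this
    omega
  have hb1 : ∀ b : MulAut N, (∀ x ∈ O, b x = x) → ∀ n, b n * n⁻¹ ∈ K := by
    intro b hb n
    rw [hK, Subgroup.mem_centralizer_iff]
    intro x hx
    have h1 := hb _ (hn.conj_mem x hx n⁻¹)
    rw [map_mul, map_mul, hb x hx, map_inv, map_inv] at h1
    have h2 : (b n)⁻¹ * x * b n = n⁻¹ * x * n := by simpa using h1
    calc x * (b n * n⁻¹) = b n * ((b n)⁻¹ * x * b n) * n⁻¹ := by group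
      _ = b n * n⁻¹ * x := by rw [h2]; group
  have hb2 : ∀ b : MulAut N, (∀ x ∈ O, b x = x) → ∀ k ∈ K, b k = k := by
    intro b hb
    apply small_fix K hK2
    intro k hk
    rw [hK, Subgroup.mem_centralizer_iff]
    intro x hx
    rw [← hb x hx, ← map_mul, ← map_mul, Subgroup.mem_centralizer_iff.1 hk x hx]
  have hbc : ∀ b b' : MulAut N, (∀ x ∈ O, b x = x) → (∀ x ∈ O, b' x = x) → b * b' = b' * b := by
    intro b b' hb hb'
    have key : ∀ b b' : MulAut N, (∀ x ∈ O, b x = x) → (∀ x ∈ O, b' x = x) → ∀ n,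
        (b * b') n = (b' n * n⁻¹) * (b n * n⁻¹) * n := by
      intro b b' hb hb' n
      rw [MulAut.mul_apply]
      have : b (b' n) = b ((b' n * n⁻¹) * n) := by rw [inv_mul_cancel_right]
      rw [this, map_mul, hb2 b hb _ (hb1 b' hb' n)]
      group
    ext n
    rw [key b b' hb hb', key b' b hb' hb, small_comm K hK2 _ _ (hb1 b' hb' n) (hb1 b hb n)]
  have hR : (MulAut.conj (G := N)).range.Normal := conjRange_normal
  have hfin := perf_triv C.simple C.nc
    ((QuotientGroup.mk' (MulAut.conj (G := N)).range).comp C.la) (by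
    have hbeta : ∀ a, ∃ b : MulAut N, (∀ x ∈ O, b x = x) ∧
        QuotientGroup.mk' (MulAut.conj (G := N)).range (C.la a) =
          QuotientGroup.mk' (MulAut.conj (G := N)).range b := by
      intro a
      refine ⟨C.la a * (MulAut.conj (m a))⁻¹, ?_, ?_⟩
      · intro x hx
        rw [MulAut.mul_apply, ← map_inv, MulAut.conj_apply, hm a _ (hn.conj_mem x hx _)]
        group
      · rw [map_mul]
        have : QuotientGroup.mk' (MulAut.conj (G := N)).range (MulAut.conj (m a))⁻¹ = 1 := by
          rw [← MonoidHom.mem_ker, QuotientGroup.ker_mk']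
          exact ⟨(m a)⁻¹, map_inv _ _⟩
        rw [this, mul_one]
    intro a b
    obtain ⟨x, hx, hx'⟩ := hbeta a
    obtain ⟨y, hy, hy'⟩ := hbeta b
    rw [MonoidHom.comp_apply, MonoidHom.comp_apply, hx', hy', ← map_mul, ← map_mul,
      hbc x y hx hy])
  intro a
  have h1 := hfin a
  rw [MonoidHom.comp_apply, ← MonoidHom.mem_ker, QuotientGroup.ker_mk'] at h1
  obtain ⟨n, hn⟩ := h1
  exact ⟨n, hn.symm⟩

end Cfg

theorem zmod5_aux : ∀ j : ZMod 5, j ≠ 0 → j * j * j * j - 1 = 0 := by decide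

theorem fixcount {α : Type} [Finite α] (f : Equiv.Perm α) (h5 : f ^ 5 = 1) :
    Nat.card α ≡ Nat.card {x // f x = x} [MOD 5] := by
  classical
  have := Fintype.ofFinite α
  have hp : Fact (Nat.Prime 5) := ⟨by norm_num⟩
  let F : Function.End α := ⇑f
  have hF : F ^ 5 ^ 1 = 1 := by
    have := congrArg (fun g : Equiv.Perm α => (⇑g : α → α)) h5
    rw [pow_one]
    funext x
    have := congrFun this x
    simp only [pow_succ, pow_zero, one_mul, Equiv.Perm.mul_apply] at this
    exact this
  have key : Fintype.card α ≡ Fintype.card (Function.fixedPoints (⇑f : α → α)) [MOD 5] :=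
    Equiv.Perm.card_fixedPoints_modEq (f := F) (p := 5) (n := 1) hF
  rw [← Nat.card_eq_fintype_card, ← Nat.card_eq_fintype_card] at key
  exact key

namespace Cfg
variable {A N : Type} [Group A] [Group N]
open scoped Pointwise

theorem mem_smul {p : ℕ} {N : Type} [Group N] (h : MulAut N) (P : Sylow p N) (x : N) : x ∈ h • P ↔ h⁻¹ x ∈ P := by
  have : x ∈ h • (P : Subgroup N) ↔ h⁻¹ • x ∈ (P : Subgroup N) :=
    Subgroup.mem_pointwise_smul_iff_inv_smul_mem
  exact this

theorem apply_mem_smul {p : ℕ} {N : Type} [Group N] (h : MulAut N) (P : Sylow p N) (x : N) (hx : x ∈ P) : h x ∈ h • P := by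
  rw [mem_smul, MulAut.inv_apply_self]; exact hx

theorem smul_eq_of_fix {p : ℕ} {N : Type} [Group N] (h : MulAut N) (P : Sylow p N) (hx : ∀ x ∈ P, h x = x) : h • P = P := by
  apply Sylow.ext
  have h1 : ∀ x ∈ P, h⁻¹ x = x := fun x hx' => by
    rw [MulAut.inv_apply, MulEquiv.symm_apply_eq, hx x hx']
  ext x
  change x ∈ h • P ↔ x ∈ P
  rw [mem_smul]
  constructor
  · intro h2
    have := hx _ h2
    rw [MulAut.apply_inv_self] at this
    rw [this]; exact h2
  · intro h2
    rw [h1 x h2]; exact h2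

theorem cent5 (C : Cfg A N) (h : MulAut N) (h5 : h ^ 5 = 1) (P : Sylow 5 N) (hP : h • P = P) :
    ∀ x ∈ P, h x = x := by
  have := C.finN
  apply fix5_sub h h5 (P : Subgroup N) (C.cardQ P).le
  intro x hx
  have := apply_mem_smul h P x hx
  rw [hP] at this
  exact this

theorem trivO (C : Cfg A N) (Q : Sylow 5 N) (h : MulAut N)
    (hP : ∀ P : Sylow 5 N, ∀ x ∈ P, h x = x) :
    ∀ x ∈ Subgroup.normalClosure (Q : Set N), h x = x := by
  let F : Subgroup N :=
    { carrier := {x | h x = x}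
      one_mem' := map_one h
      mul_mem' := by
        intro a b ha hb
        change h (a * b) = a * b
        rw [map_mul]
        rw [show h a = a from ha, show h b = b from hb]
      inv_mem' := by
        intro a ha
        change h a⁻¹ = a⁻¹
        rw [map_inv, show h a = a from ha] }
  have : Subgroup.normalClosure (Q : Set N) ≤ F := by
    unfold Subgroup.normalClosure
    rw [Subgroup.closure_le]
    intro x hx
    rw [Group.mem_conjugatesOfSet_iff] at hx
    obtain ⟨y, hy, hc⟩ := hx
    rw [isConj_iff] at hc
    obtain ⟨c, rfl⟩ := hc
    exact hP (MulAut.conj c • Q) _ (apply_mem_smul (MulAut.conj c) Q y hy)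
  exact fun x hx => this hx

theorem gen (C : Cfg A N) (Q : Sylow 5 N) (x : N) (hx : x ∈ Q) (h1 : x ≠ 1) :
    Subgroup.zpowers x = (Q : Subgroup N) := by
  have := C.finN
  apply Subgroup.eq_of_le_of_card_ge
  · rw [Subgroup.zpowers_le]; exact hx
  · have h5 : x ^ 5 = 1 := by
      have : (⟨x, hx⟩ : Q) ^ Nat.card Q = 1 := pow_card_eq_one'
      rw [C.cardQ Q] at this
      exact congrArg Subtype.val this
    have hp : Fact (Nat.Prime 5) := ⟨by norm_num⟩
    rw [Nat.card_zpowers, orderOf_eq_prime h5 h1]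
    exact (C.cardQ Q).le

theorem pow5 (C : Cfg A N) (Q : Sylow 5 N) (x : N) (hx : x ∈ Q) : x ^ 5 = 1 := by
  have := C.finN
  have : (⟨x, hx⟩ : Q) ^ Nat.card Q = 1 := pow_card_eq_one'
  rw [C.cardQ Q] at this
  exact congrArg Subtype.val this

theorem commQ (C : Cfg A N) (Q : Sylow 5 N) (x y : N) (hx : x ∈ Q) (hy : y ∈ Q) :
    x * y = y * x := by
  have hp : Fact (Nat.Prime 5) := ⟨by norm_num⟩
  have hcyc : IsCyclic Q := isCyclic_of_prime_card (C.cardQ Q)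
  exact congrArg Subtype.val (hcyc.isMulCommutative.is_comm.comm (⟨x, hx⟩ : Q) ⟨y, hy⟩)

theorem selfnorm (C : Cfg A N) (Q P : Sylow 5 N) (x : N) (hx : x ∈ Q) (h1 : x ≠ 1)
    (h : x • P = P) : P = Q := by
  have := C.finN
  have hp : Fact (Nat.Prime 5) := ⟨by norm_num⟩
  rw [Sylow.smul_eq_iff_mem_normalizer] at h
  have h2 := Q.2.inf_normalizer_sylow P
  have h3 : x ∈ (Q : Subgroup N) ⊓ Subgroup.normalizer (P : Set N) := ⟨hx, h⟩
  rw [h2] at h3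
  apply Sylow.ext
  rw [← C.gen Q x hx h1, ← C.gen P x h3.2 h1]

theorem start (C : Cfg A N) : ∃ a : A, a ≠ 1 ∧ (C.la a) ^ 5 = 1 ∧
    ∃ Q : Sylow 5 N, ∀ x ∈ Q, C.la a x = x := by
  have := C.finN
  have := C.finA
  have hp : Fact (Nat.Prime 5) := ⟨by norm_num⟩
  obtain ⟨a, ha⟩ := exists_prime_orderOf_dvd_card' (G := A) 5 (by rw [C.cardA]; norm_num)
  have h5 : (C.la a) ^ 5 = 1 := by rw [← map_pow, ← ha, pow_orderOf_eq_one, map_one]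
  refine ⟨a, ?_, h5, ?_⟩
  · rintro rfl
    rw [orderOf_one] at ha
    omega
  · have h1 := fixcount (MulAction.toPerm (C.la a) : Equiv.Perm (Sylow 5 N)) (by
      have : (MulAction.toPermHom (MulAut N) (Sylow 5 N) (C.la a)) ^ 5 = 1 := by
        rw [← map_pow, h5, map_one]
      exact this)
    have h2 := card_sylow_modEq_one 5 N
    have h3 : 0 < Nat.card {x : Sylow 5 N // (MulAction.toPerm (C.la a) : Equiv.Perm (Sylow 5 N)) x = x} := by
      unfold Nat.ModEq at h1 h2
      omega
    obtain ⟨⟨Q, hQ⟩⟩ := (Nat.card_pos_iff.1 h3).1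
    exact ⟨Q, C.cent5 _ h5 Q hQ⟩

theorem finishO (C : Cfg A N) (a : A) (ha : a ≠ 1) (q : N) (h5 : (MulAut.conj q * C.la a) ^ 5 = 1)
    (h : ∀ P : Sylow 5 N, (MulAut.conj q * C.la a) • P = P) (Q : Sylow 5 N) :
    ∀ a, ∃ n, C.la a = MulAut.conj n := by
  have h1 := C.trivO Q _ (fun P => C.cent5 _ h5 P (h P))
  refine C.L4 Q a ha q⁻¹ ?_
  intro x hx
  have h2 := h1 x hx
  rw [MulAut.mul_apply, MulAut.conj_apply] at h2
  conv_rhs => rw [← h2]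
  group

theorem pow4 (C : Cfg A N) (Q : Sylow 5 N) (n : N) (hn : n ∈ Subgroup.normalizer (Q : Set N)) :
    n ^ 4 ∈ Subgroup.centralizer (Q : Set N) := by
  have hp : Fact (Nat.Prime 5) := ⟨by norm_num⟩
  have hcyc : IsCyclic Q := isCyclic_of_prime_card (C.cardQ Q)
  have hf : ∀ x : Q, n * x * n⁻¹ ∈ Q := fun x => (Subgroup.mem_normalizer_iff.1 hn x).1 x.2
  let f : Q →* Q := MonoidHom.mk' (fun x => ⟨n * x * n⁻¹, hf x⟩) (fun x y => by
    apply Subtype.ext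
    simp)
  obtain ⟨i, hi⟩ := MonoidHom.map_cyclic f
  have hi' : ∀ x ∈ Q, n * x * n⁻¹ = x ^ i := fun x hx => congrArg Subtype.val (hi ⟨x, hx⟩)
  have hz : ∀ x ∈ Q, ∀ j : ℤ, n * x ^ j * n⁻¹ = x ^ (j * i) := fun x hx j => by
    rw [hi' _ (Subgroup.zpow_mem _ hx j), zpow_mul]
  have h4 : ∀ x ∈ Q, n ^ 4 * x * (n ^ 4)⁻¹ = x ^ (i * i * i * i) := fun x hx => by
    rw [← hz x hx, ← hz x hx, ← hz x hx, ← hi' x hx]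
    simp only [pow_succ, pow_zero, one_mul, mul_inv_rev, mul_assoc]
  rw [Subgroup.mem_centralizer_iff]
  intro x hx
  rw [eq_comm, ← mul_inv_eq_iff_eq_mul]
  rw [h4 x hx]
  by_cases hx1 : x = 1
  · rw [hx1, one_zpow]
  have h5 := C.pow5 Q x hx
  have h6 : (i : ZMod 5) ≠ 0 := by
    intro h0
    rw [ZMod.intCast_zmod_eq_zero_iff_dvd] at h0
    obtain ⟨k, hk⟩ := h0
    have := hi' x hx
    rw [hk, zpow_mul] at this
    have h7 : x ^ ((5 : ℕ) : ℤ) = 1 := by rw [zpow_natCast, h5]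
    rw [h7, one_zpow, mul_inv_eq_one, mul_eq_left] at this
    exact hx1 this
  have h8 : ((i * i * i * i - 1 : ℤ) : ZMod 5) = 0 := by
    push_cast
    exact zmod5_aux _ h6
  rw [ZMod.intCast_zmod_eq_zero_iff_dvd] at h8
  obtain ⟨k, hk⟩ := h8
  have h9 : i * i * i * i = 1 + (5 : ℕ) * k := by linarith
  rw [h9, zpow_add, zpow_one, zpow_mul, zpow_natCast, h5, one_zpow, mul_one]

theorem n5 (C : Cfg A N) : (Nat.card (Sylow 5 N) = 1 ∨ Nat.card (Sylow 5 N) = 6 ∨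
    Nat.card (Sylow 5 N) = 16 ∨ Nat.card (Sylow 5 N) = 36) ∧ ∀ Q : Sylow 5 N,
    Nat.card (Sylow 5 N) * Nat.card (Subgroup.normalizer (Q : Set N)) = 720 := by
  have := C.finN
  have hp : Fact (Nat.Prime 5) := ⟨by norm_num⟩
  have h2 : ∀ Q : Sylow 5 N,
    Nat.card (Sylow 5 N) * Nat.card (Subgroup.normalizer (Q : Set N)) = 720 := fun Q => by
    rw [Q.card_eq_index_normalizer, mul_comm, Subgroup.card_mul_index, C.cardN]
  refine ⟨?_, h2⟩
  have h1 := card_sylow_modEq_one 5 N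
  obtain ⟨Q⟩ := (inferInstance : Nonempty (Sylow 5 N))
  have h3 := h2 Q
  have h4 : Nat.card (Sylow 5 N) ∣ 144 := by
    have h5 : Nat.card (Sylow 5 N) ∣ 5 * 144 := ⟨_, h3.symm⟩
    refine Nat.Coprime.dvd_of_dvd_mul_left ?_ h5
    exact ((Nat.Prime.coprime_iff_not_dvd (by norm_num)).2 (not_dvd_card_sylow 5 N)).symm
  have h5 : Nat.card (Sylow 5 N) ∈ Nat.divisors 144 := by simp [h4]
  rw [show Nat.divisors 144 = {1, 2, 3, 4, 6, 8, 9, 12, 16, 18, 24, 36, 48, 72, 144} by decide +kernel] at h5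
  unfold Nat.ModEq at h1
  simp only [Finset.mem_insert, Finset.mem_singleton] at h5
  omega

theorem case1 (C : Cfg A N) (h : Nat.card (Sylow 5 N) = 1) : False := by
  have := C.finN
  have hp : Fact (Nat.Prime 5) := ⟨by norm_num⟩
  obtain ⟨hs, hne⟩ := Nat.card_eq_one_iff_unique.1 h
  obtain ⟨Q⟩ := hne
  have hcyc : IsCyclic Q := isCyclic_of_prime_card (C.cardQ Q)
  have hm : ∀ a, ∀ x ∈ Q, C.la a x ∈ Q := fun a x hx => by
    have := apply_mem_smul (C.la a) Q x hx
    rwa [Subsingleton.elim (C.la a • Q) Q] at this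
  let e : A →* Monoid.End Q :=
    { toFun := fun a => MonoidHom.mk' (fun x => ⟨C.la a x, hm a x x.2⟩) (fun x y => by
        apply Subtype.ext; simp)
      map_one' := by
        ext x
        change C.la 1 x = x
        rw [map_one]; rfl
      map_mul' := by
        intro a b
        ext x
        change C.la (a * b) x = C.la a (C.la b x)
        rw [map_mul]; rfl }
  have he := cyc_triv C.simple C.nc e
  apply C.kk Q
  intro a
  apply C.trivO
  intro P x hx
  rw [Subsingleton.elim P Q] at hx
  exact congrArg (fun f : Monoid.End Q => ((f ⟨x, hx⟩ : Q) : N)) (he a)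

theorem case16 (C : Cfg A N) (h : Nat.card (Sylow 5 N) = 16) : False := by
  have := C.finN
  obtain ⟨Q⟩ := (inferInstance : Nonempty (Sylow 5 N))
  have h1 := C.n5.2 Q
  rw [h] at h1
  have h2 : Nat.card (Subgroup.normalizer (Q : Set N)) = 45 := by omega
  apply C.L3 Q
  intro n hn
  have h3 := C.pow4 Q n hn
  have h4 : n ^ 45 = 1 := by
    have : (⟨n, hn⟩ : Subgroup.normalizer (Q : Set N)) ^ Nat.card (Subgroup.normalizer (Q : Set N)) = 1 :=
      pow_card_eq_one'
    rw [h2] at this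
    exact congrArg Subtype.val this
  have h5 : n = n ^ 45 * ((n ^ 4) ^ 11)⁻¹ := by group
  rw [h5, h4, one_mul]
  exact Subgroup.inv_mem _ (Subgroup.pow_mem _ h3 11)

theorem commh (C : Cfg A N) (Q : Sylow 5 N) (h : MulAut N) (hQ : ∀ x ∈ Q, h x = x)
    (x : N) (hx : x ∈ Q) : MulAut.conj x * h = h * MulAut.conj x := by
  ext n
  simp [MulAut.mul_apply, hQ x hx]

theorem hq5 (C : Cfg A N) (Q : Sylow 5 N) (h : MulAut N) (h5 : h ^ 5 = 1) (hQ : ∀ x ∈ Q, h x = x)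
    (x : N) (hx : x ∈ Q) : (MulAut.conj x * h) ^ 5 = 1 := by
  have : Commute (MulAut.conj x) h := C.commh Q h hQ x hx
  rw [this.mul_pow, h5, ← map_pow, C.pow5 Q x hx, map_one, mul_one]

theorem case6 (C : Cfg A N) (h : Nat.card (Sylow 5 N) = 6) :
    ∀ a, ∃ n, C.la a = MulAut.conj n := by
  have := C.finN
  obtain ⟨a, ha, h5, Q, hQ⟩ := C.start
  have hQf := smul_eq_of_fix (C.la a) Q hQ
  have : Nontrivial (Sylow 5 N) := Finite.one_lt_card_iff_nontrivial.1 (by rw [h]; norm_num)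
  obtain ⟨P, hP⟩ := exists_ne Q
  let φ : Option Q → Sylow 5 N := fun o => match o with
    | none => Q
    | some q => (q : N) • P
  have hφ : Function.Injective φ := by
    have hfix : ∀ q : Q, (q : N) • Q = Q := fun q => by
      rw [Sylow.smul_eq_iff_mem_normalizer]; exact Subgroup.le_normalizer q.2
    have hne : ∀ q : Q, (q : N) • P ≠ Q := fun q hq => by
      exact hP (smul_left_cancel _ (hq.trans (hfix q).symm))
    rintro (_ | q) (_ | q') hqq
    · rfl
    · exact (hne q' hqq.symm).elim
    · exact (hne q hqq).elim
    · have h1 : (q : N) • P = (q' : N) • P := hqq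
      congr 1
      by_contra hn
      apply hP
      refine C.selfnorm Q P ((q' : N)⁻¹ * q) (Q.mul_mem (Q.inv_mem q'.2) q.2) ?_ ?_
      · intro h2
        exact hn (Subtype.ext (inv_mul_eq_one.1 h2).symm)
      · rw [mul_smul, h1, inv_smul_smul]
  have hsur : Function.Surjective φ := by
    refine ((Nat.bijective_iff_injective_and_card φ).2 ⟨hφ, ?_⟩).2
    rw [Finite.card_option, C.cardQ Q, h]
  obtain ⟨o, ho⟩ := hsur (C.la a • P)
  rcases o with _ | q
  · exfalso
    have : Q = C.la a • P := ho
    apply hP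
    rw [← hQf] at this
    exact (smul_left_cancel _ this).symm
  have ho : MulAut.conj (q : N) • P = C.la a • P := ho
  have hq' : (q : N)⁻¹ ∈ Q := Q.inv_mem q.2
  refine C.finishO a ha (q : N)⁻¹ (C.hq5 Q _ h5 hQ _ hq') ?_ Q
  have hkP : (MulAut.conj (q : N)⁻¹ * C.la a) • P = P := by
    rw [mul_smul, ← ho, map_inv, inv_smul_smul]
  intro R
  obtain ⟨o, rfl⟩ := hsur R
  rcases o with _ | r
  · apply smul_eq_of_fix
    intro x hx
    rw [MulAut.mul_apply, hQ x hx, MulAut.conj_apply, C.commQ Q _ _ hq' hx]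
    group
  · change (MulAut.conj (q : N)⁻¹ * C.la a) • MulAut.conj (r : N) • P = MulAut.conj (r : N) • P
    conv_rhs => rw [← hkP]
    rw [← mul_smul, ← mul_smul, ← mul_assoc, mul_assoc, ← C.commh Q _ hQ r r.2, ← mul_assoc,
      ← map_mul, C.commQ Q _ _ hq' r.2, map_mul]
end Cfg

namespace Cfg
variable {A N : Type} [Group A] [Group N]
open scoped Pointwise

def fixSub (h : MulAut N) : Subgroup N where
  carrier := {x | h x = x}
  one_mem' := map_one h
  mul_mem' := by
    intro a b ha hb
    change h (a * b) = a * b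
    rw [map_mul]
    rw [show h a = a from ha, show h b = b from hb]
  inv_mem' := by
    intro a ha
    change h a⁻¹ = a⁻¹
    rw [map_inv, show h a = a from ha]

theorem mem_fixSub (h : MulAut N) (x : N) : x ∈ fixSub h ↔ h x = x := Iff.rfl

theorem QleL (Q : Sylow 5 N) (h : MulAut N) (hQ : ∀ x ∈ Q, h x = x) :
    (Q : Subgroup N) ≤ fixSub h := fun x hx => hQ x hx

theorem conj_fix (h : MulAut N) (n : N) (hn : h n = n) : h * MulAut.conj n = MulAut.conj n * h := by
  ext x
  simp [MulAut.mul_apply, hn]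

theorem mem_norm_sub (Q : Sylow 5 N) (h : MulAut N) (hQ : ∀ x ∈ Q, h x = x) (l : fixSub h) :
    l ∈ Subgroup.normalizer (Q.subtype (QleL Q h hQ) : Set (fixSub h)) ↔
      (l : N) ∈ Subgroup.normalizer (Q : Set N) := by
  rw [← Sylow.smul_eq_iff_mem_normalizer, ← Sylow.smul_eq_iff_mem_normalizer, Sylow.smul_subtype]
  constructor
  · intro h1; exact Sylow.subtype_injective h1
  · intro h1
    apply Sylow.ext
    rw [Sylow.coe_subtype, Sylow.coe_subtype]
    congr 1
    exact congrArg (fun P : Sylow 5 N => (P : Subgroup N)) h1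

theorem fixdata (C : Cfg A N) (Q : Sylow 5 N) (h : MulAut N) (h5 : h ^ 5 = 1)
    (hQ : ∀ x ∈ Q, h x = x) :
    Nat.card {P : Sylow 5 N // h • P = P} *
      Nat.card (fixSub h ⊓ Subgroup.normalizer (Q : Set N) : Subgroup N) = Nat.card (fixSub h) := by
  have := C.finN
  have hp : Fact (Nat.Prime 5) := ⟨by norm_num⟩
  have hQL := QleL Q h hQ
  have h1 : Nat.card {P : Sylow 5 N // h • P = P} = Nat.card (Sylow 5 (fixSub h)) := by
    refine Nat.card_congr (Equiv.ofBijective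
      (fun P => P.1.subtype (QleL P.1 h (C.cent5 h h5 P.1 P.2))) ⟨?_, ?_⟩)
    · intro P P' hPP
      exact Subtype.ext (Sylow.subtype_injective hPP)
    · intro R
      obtain ⟨l, hl⟩ := MulAction.exists_smul_eq (fixSub h) (Q.subtype hQL) R
      refine ⟨⟨(l : N) • Q, ?_⟩, ?_⟩
      · rw [Sylow.smul_def, ← mul_smul, conj_fix h l l.2, mul_smul, smul_eq_of_fix h Q hQ]
      · rw [← hl, Sylow.smul_subtype]; rfl
  have h2 : Nat.card (fixSub h ⊓ Subgroup.normalizer (Q : Set N) : Subgroup N) =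
      Nat.card (Subgroup.normalizer (Q.subtype hQL : Set (fixSub h))) := by
    refine Nat.card_congr ⟨fun x => ⟨⟨x, x.2.1⟩, (mem_norm_sub Q h hQ _).2 x.2.2⟩,
      fun y => ⟨y.1.1, y.1.2, (mem_norm_sub Q h hQ _).1 y.2⟩, fun x => rfl, fun y => rfl⟩
  rw [h1, h2, (Q.subtype hQL).card_eq_index_normalizer, mul_comm, Subgroup.card_mul_index]

theorem fixM (C : Cfg A N) (Q : Sylow 5 N) (h : MulAut N) (h5 : h ^ 5 = 1)
    (hQ : ∀ x ∈ Q, h x = x) (hM : Nat.card (Subgroup.normalizer (Q : Set N)) = 20) :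
    ∃ q ∈ Q, ∀ n ∈ Subgroup.normalizer (Q : Set N), (MulAut.conj q * h) n = n := by
  have := C.finN
  have hp : Fact (Nat.Prime 2) := ⟨by norm_num⟩
  set M := Subgroup.normalizer (Q : Set N) with hMdef
  have hhQ := smul_eq_of_fix h Q hQ
  have hhM : ∀ n ∈ M, h n ∈ M := by
    intro n hn
    rw [hMdef, ← Sylow.smul_eq_iff_mem_normalizer] at hn ⊢
    have h1 : MulAut.conj (h n) = h * MulAut.conj n * h⁻¹ := by
      ext x; simp [MulAut.mul_apply]
    rw [Sylow.smul_def, h1, mul_smul, mul_smul, inv_smul_eq_iff.2 hhQ.symm, ← Sylow.smul_def, hn, hhQ]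
  have hinj : Function.Injective (fun x : M => (⟨h x, hhM x x.2⟩ : M)) := by
    intro x y hxy
    have := congrArg Subtype.val hxy
    exact Subtype.ext (h.injective this)
  let f : MulAut M := MulEquiv.ofBijective
    (MonoidHom.mk' (fun x : M => (⟨h x, hhM x x.2⟩ : M)) (fun x y => Subtype.ext (by simp)))
    (Finite.injective_iff_bijective.1 hinj)
  have hf : ∀ x : M, ((f x : M) : N) = h x := fun x => rfl
  obtain ⟨T⟩ := (inferInstance : Nonempty (Sylow 2 M))
  have hT : Nat.card T = 4 := by
    rw [T.card_eq_multiplicity, hM]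
    have : Nat.factorization 20 2 = 2 := by
      rw [Nat.factorization_def _ (by norm_num)]
      rw [show 20 = 2 ^ 2 * 5 by norm_num, padicValNat.mul (by norm_num) (by norm_num)]
      rw [padicValNat.prime_pow, padicValNat.eq_zero_of_not_dvd (by norm_num)]
    rw [this]
    norm_num
  have hQM : (Q : Subgroup N) ≤ M := Subgroup.le_normalizer
  have hQ' : Nat.card ((Q : Subgroup N).subgroupOf M) = 5 := by
    exact (Nat.card_congr (Subgroup.subgroupOfEquivOfLe hQM).toEquiv).trans (C.cardQ Q)
  have hcomp : Subgroup.IsComplement' ((Q : Subgroup N).subgroupOf M) (T : Subgroup M) := by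
    apply Subgroup.isComplement'_of_coprime
    · rw [hQ', hM]
      change 5 * Nat.card T = 20
      rw [hT]
    · rw [hQ']
      change Nat.Coprime 5 (Nat.card T)
      rw [hT]
      norm_num
  have hqt : ∀ m : M, ∃ q ∈ Q, ∃ t ∈ T, (m : N) = q * t := by
    intro m
    obtain ⟨⟨⟨q, hq⟩, t⟩, hqt⟩ := hcomp.2 m
    exact ⟨q, hq, t, t.2, (congrArg Subtype.val hqt).symm⟩
  obtain ⟨m, hm⟩ := MulAction.exists_smul_eq M T (f • T)
  obtain ⟨q, hq, t, ht, hmqt⟩ := hqt m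
  have hq' := Q.inv_mem hq
  refine ⟨q⁻¹, hq', ?_⟩
  have hk5 := C.hq5 Q h h5 hQ _ hq'
  have hkQ : ∀ x ∈ Q, (MulAut.conj q⁻¹ * h) x = x := by
    intro x hx
    rw [MulAut.mul_apply, hQ x hx, MulAut.conj_apply, C.commQ Q _ _ hq' hx]
    group
  have hkT : ∀ x ∈ (T : Subgroup M).map M.subtype, (MulAut.conj q⁻¹ * h) x = x := by
    apply fix5_sub _ hk5
    · rw [Subgroup.card_map_of_injective M.subtype_injective]
      change Nat.card T ≤ 5
      omega
    · rintro _ ⟨s, hs, rfl⟩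
      have h1 := apply_mem_smul f T s hs
      rw [← hm, Sylow.smul_def, mem_smul, ← map_inv, MulAut.conj_apply] at h1
      refine ⟨t * (m⁻¹ * f s * m⁻¹⁻¹) * t⁻¹, T.mul_mem (T.mul_mem ht h1) (T.inv_mem ht), ?_⟩
      simp only [Subgroup.coe_subtype, Subgroup.coe_mul, Subgroup.coe_inv, hf, MulAut.mul_apply,
        MulAut.conj_apply, hmqt]
      group
  intro n hn
  obtain ⟨r, hr, s, hs, hrs⟩ := hqt ⟨n, hn⟩
  have hrs : n = r * s := hrs
  rw [hrs, map_mul, hkQ r hr, hkT s ⟨s, hs, rfl⟩]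

/-- centralizer via one element -/
theorem cent_iff (C : Cfg A N) (Q : Sylow 5 N) (x : N) (hx : x ∈ Q) (h1 : x ≠ 1) (n : N) :
    n * x = x * n ↔ n ∈ Subgroup.centralizer (Q : Set N) := by
  constructor
  · intro h
    have h2 : (Q : Subgroup N) ≤ Subgroup.centralizer {n} := by
      rw [← C.gen Q x hx h1, Subgroup.zpowers_le, Subgroup.mem_centralizer_iff]
      rintro _ rfl
      exact h
    rw [Subgroup.mem_centralizer_iff]
    intro y hy
    exact (Subgroup.mem_centralizer_iff.1 (h2 hy) n rfl).symm
  · intro h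
    exact (Subgroup.mem_centralizer_iff.1 h x hx).symm

theorem c5 (C : Cfg A N) (Q : Sylow 5 N) (hM : Nat.card (Subgroup.normalizer (Q : Set N)) = 20) :
    Nat.card (Subgroup.centralizer (Q : Set N)) = 5 ∨
      Nat.card (Subgroup.centralizer (Q : Set N)) = 10 := by
  have := C.finN
  have hle : Subgroup.centralizer (Q : Set N) ≤ Subgroup.normalizer (Q : Set N) :=
    Subgroup.centralizer_le_normalizer _
  have hQ : (Q : Subgroup N) ≤ Subgroup.centralizer (Q : Set N) := by
    intro x hx
    rw [Subgroup.mem_centralizer_iff]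
    intro y hy
    exact C.commQ Q y x hy hx
  have h1 := Subgroup.card_dvd_of_le hle
  have h2 := Subgroup.card_dvd_of_le hQ
  change Nat.card Q ∣ _ at h2
  rw [C.cardQ Q] at h2
  rw [hM] at h1
  have h3 : Nat.card (Subgroup.centralizer (Q : Set N)) ≠ 20 := by
    intro h20
    have := Subgroup.eq_of_le_of_card_ge hle (by rw [h20, hM])
    exact C.L3 Q this.ge
  obtain ⟨k, hk⟩ := h2
  rw [hk] at h1 h3 ⊢
  have h4 : k ∣ 4 := by
    obtain ⟨j, hj⟩ := h1
    exact ⟨j, by nlinarith⟩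
  have h5 := Nat.le_of_dvd (by norm_num) h4
  interval_cases k <;> omega

/-- setting for `n5 = 36` -/
structure S36 (C : Cfg A N) (Q : Sylow 5 N) (h : MulAut N) : Prop where
  n36 : Nat.card (Sylow 5 N) = 36
  h5 : h ^ 5 = 1
  hM : ∀ n ∈ Subgroup.normalizer (Q : Set N), h n = n

namespace S36
variable {C : Cfg A N} {Q : Sylow 5 N} {h : MulAut N}

theorem m20 (S : S36 C Q h) : Nat.card (Subgroup.normalizer (Q : Set N)) = 20 := by
  have := C.n5.2 Q
  rw [S.n36] at this
  omega

theorem hQ (S : S36 C Q h) : ∀ x ∈ Q, h x = x := fun x hx => S.hM x (Subgroup.le_normalizer hx)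

theorem kQ (S : S36 C Q h) (q : N) (hq : q ∈ Q) : ∀ x ∈ Q, (MulAut.conj q * h) x = x := by
  intro x hx
  rw [MulAut.mul_apply, S.hQ x hx, MulAut.conj_apply, C.commQ Q _ _ hq hx]
  group

theorem k5 (S : S36 C Q h) (q : N) (hq : q ∈ Q) : (MulAut.conj q * h) ^ 5 = 1 :=
  C.hq5 Q h S.h5 S.hQ q hq

theorem mod5 (S : S36 C Q h) (q : N) (hq : q ∈ Q) :
    Nat.card {P : Sylow 5 N // (MulAut.conj q * h) • P = P} % 5 = 1 := by
  have := C.finN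
  have h1 := fixcount (MulAction.toPerm (MulAut.conj q * h) : Equiv.Perm (Sylow 5 N)) (by
      have : (MulAction.toPermHom (MulAut N) (Sylow 5 N) (MulAut.conj q * h)) ^ 5 = 1 := by
        rw [← map_pow, S.k5 q hq, map_one]
      exact this)
  rw [S.n36] at h1
  exact h1.symm

theorem NLC (S : S36 C Q h) (q : N) (hq : q ∈ Q) (h1 : q ≠ 1) :
    (fixSub (MulAut.conj q * h) ⊓ Subgroup.normalizer (Q : Set N) : Subgroup N) =
      Subgroup.centralizer (Q : Set N) := by
  ext n
  rw [Subgroup.mem_inf, mem_fixSub]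
  constructor
  · rintro ⟨h2, h3⟩
    rw [MulAut.mul_apply, S.hM n h3, MulAut.conj_apply, mul_inv_eq_iff_eq_mul] at h2
    exact (C.cent_iff Q q hq h1 n).1 h2.symm
  · intro h2
    have h3 := Subgroup.centralizer_le_normalizer _ h2
    refine ⟨?_, h3⟩
    rw [MulAut.mul_apply, S.hM n h3, MulAut.conj_apply, mul_inv_eq_iff_eq_mul]
    exact ((C.cent_iff Q q hq h1 n).2 h2).symm

theorem cnt (S : S36 C Q h) (q : N) (hq : q ∈ Q) (h1 : q ≠ 1) :
    Nat.card {P : Sylow 5 N // (MulAut.conj q * h) • P = P} *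
      Nat.card (Subgroup.centralizer (Q : Set N)) = Nat.card (fixSub (MulAut.conj q * h)) := by
  rw [← S.NLC q hq h1]
  exact C.fixdata Q _ (S.k5 q hq) (S.kQ q hq)

theorem no6 (S : S36 C Q h) (q : N) (hq : q ∈ Q) (h1 : q ≠ 1)
    (h6 : Nat.card {P : Sylow 5 N // (MulAut.conj q * h) • P = P} = 6) : False := by
  have := C.finN
  have hp : Fact (Nat.Prime 5) := ⟨by norm_num⟩
  have hp3 : Fact (Nat.Prime 3) := ⟨by norm_num⟩
  have hc := S.cnt q hq h1
  rw [h6] at hc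
  set k := MulAut.conj q * h with hk
  set L := fixSub k with hL
  have hQL : (Q : Subgroup N) ≤ L := QleL Q k (S.kQ q hq)
  have hb : Subgroup.normalizer (Q.subtype hQL : Set L) ≤
      Subgroup.centralizer (Q.subtype hQL : Set L) := by
    intro l hl
    have h2 := (mem_norm_sub Q k (S.kQ q hq) l).1 hl
    have h3 : (l : N) ∈ Subgroup.centralizer (Q : Set N) := by
      rw [← S.NLC q hq h1]
      exact ⟨l.2, h2⟩
    rw [Subgroup.mem_centralizer_iff]
    intro y hy
    exact Subtype.ext (Subgroup.mem_centralizer_iff.1 h3 y hy)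
  set W := (MonoidHom.transferSylow (Q.subtype hQL) hb).ker with hW
  have hcomp := (MonoidHom.ker_transferSylow_isComplement' (Q.subtype hQL) hb).card_mul_card
  have hQ' : Nat.card (Q.subtype hQL : Subgroup L) = 5 := by
    exact (Nat.card_congr (Subgroup.subgroupOfEquivOfLe hQL).toEquiv).trans (C.cardQ Q)
  rw [hQ', ← hW] at hcomp
  have hWc : Nat.card W = 6 ∨ Nat.card W = 12 := by
    rcases C.c5 Q S.m20 with h5 | h5 <;> rw [h5] at hc <;> omega
  obtain ⟨R0⟩ := (inferInstance : Nonempty (Sylow 3 W))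
  have hR3 : ∀ R : Sylow 3 W, Nat.card R = 3 := by
    intro R
    rw [R.card_eq_multiplicity]
    have : Nat.factorization (Nat.card W) 3 = 1 := by
      rw [Nat.factorization_def _ (by norm_num)]
      rcases hWc with h7 | h7
      · rw [h7, show 6 = 3 * 2 by norm_num, padicValNat.mul (by norm_num) (by norm_num)]
        rw [padicValNat.self (by norm_num), padicValNat.eq_zero_of_not_dvd (by norm_num)]
      · rw [h7, show 12 = 3 * 4 by norm_num, padicValNat.mul (by norm_num) (by norm_num)]
        rw [padicValNat.self (by norm_num), padicValNat.eq_zero_of_not_dvd (by norm_num)]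
    rw [this, pow_one]
  have hS4 : Nat.card (Sylow 3 W) ≤ 4 := by
    have h7 := Subgroup.card_mul_index (R0 : Subgroup W)
    have h8 : Nat.card (Sylow 3 W) ∣ (R0 : Subgroup W).index := R0.card_dvd_index
    change Nat.card R0 * _ = _ at h7
    rw [hR3 R0] at h7
    have := Nat.le_of_dvd (by omega) h8
    omega
  let x : L := ⟨q, hQL hq⟩
  let g : MulAut W := MulAut.conjNormal x
  have hx5 : x ^ 5 = 1 := Subtype.ext (C.pow5 Q q hq)
  have hg5 : g ^ 5 = 1 := by
    change (MulAut.conjNormal x) ^ 5 = 1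
    rw [← map_pow, hx5, map_one]
  have hfx := fixcount (MulAction.toPerm g : Equiv.Perm (Sylow 3 W)) (by
      have : (MulAction.toPermHom (MulAut W) (Sylow 3 W) g) ^ 5 = 1 := by
        rw [← map_pow, hg5, map_one]
      exact this)
  have hpos : 0 < Nat.card (Sylow 3 W) := Nat.card_pos
  have h3 : 0 < Nat.card {R : Sylow 3 W // (MulAction.toPerm g : Equiv.Perm (Sylow 3 W)) R = R} := by
    unfold Nat.ModEq at hfx
    omega
  obtain ⟨⟨R, hR⟩⟩ := (Nat.card_pos_iff.1 h3).1
  have hR : g • R = R := hR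
  have hfixR := fix5_sub g hg5 (R : Subgroup W) (by
    change Nat.card R ≤ 5
    rw [hR3]; norm_num) (by
    intro y hy
    have := apply_mem_smul g R y hy
    rw [hR] at this
    exact this)
  have hRC : Nat.card R ∣ Nat.card (Subgroup.centralizer (Q : Set N)) := by
    let φ : R →* Subgroup.centralizer (Q : Set N) := MonoidHom.mk'
      (fun y => ⟨(((y : W) : L) : N), by
        rw [← C.cent_iff Q q hq h1]
        have h9 : g (y : W) = y := hfixR y y.2
        have h10 : (x : L) * (y : W) * x⁻¹ = (y : W) := by
          have := congrArg (fun w : W => (w : L)) h9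
          rw [← MulAut.conjNormal_apply]
          exact this
        rw [mul_inv_eq_iff_eq_mul] at h10
        exact (congrArg (fun l : L => (l : N)) h10).symm⟩)
      (fun a b => rfl)
    refine Subgroup.card_dvd_of_injective φ ?_
    intro a b hab
    have := congrArg (fun z : Subgroup.centralizer (Q : Set N) => (z : N)) hab
    exact Subtype.ext (Subtype.ext (Subtype.ext this))
  rw [hR3] at hRC
  rcases C.c5 Q S.m20 with h5 | h5 <;> rw [h5] at hRC <;> omega

end S36
end Cfg

theorem cardne {α : Type} [Finite α] (p : α → Prop) (a : α) (ha : p a) :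
    Nat.card {x // p x ∧ x ≠ a} + 1 = Nat.card {x // p x} := by
  have h1 : Nat.card {x // p x} = Set.ncard {x | p x} := rfl
  have h2 : Nat.card {x // p x ∧ x ≠ a} = Set.ncard ({x | p x} \ {a}) := rfl
  rw [h1, h2]
  exact Set.ncard_diff_singleton_add_one (s := {x | p x}) ha

theorem cardcompl {α : Type} [Finite α] (p : α → Prop) :
    Nat.card {x // p x} + Nat.card {x // ¬ p x} = Nat.card α := by
  have h1 : Nat.card {x // p x} = Set.ncard {x | p x} := rfl
  have h2 : Nat.card {x // ¬ p x} = Set.ncard ({x | p x}ᶜ) := rfl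
  rw [h1, h2]
  exact Set.ncard_add_ncard_compl _

namespace Cfg
variable {A N : Type} [Group A] [Group N]
open scoped Pointwise
namespace S36
variable {C : Cfg A N} {Q : Sylow 5 N} {h : MulAut N}

theorem hQQ (S : S36 C Q h) : h • Q = Q := smul_eq_of_fix h Q S.hQ

theorem disj (S : S36 C Q h) (q r : N) (hq : q ∈ Q) (hr : r ∈ Q) (P : Sylow 5 N)
    (h1 : (MulAut.conj q * h) • P = P) (h2 : (MulAut.conj r * h) • P = P) (hP : P ≠ Q) : q = r := by
  by_contra hne
  apply hP
  have h3 : (r⁻¹ * q) • (h • P) = h • P := by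
    rw [mul_smul] at h1 h2
    rw [mul_smul, inv_smul_eq_iff]
    exact h1.trans h2.symm
  have h4 := C.selfnorm Q (h • P) (r⁻¹ * q) (Q.mul_mem (Q.inv_mem hr) hq)
    (fun h5 => hne (inv_mul_eq_one.1 h5).symm) h3
  exact smul_left_cancel h (h4.trans S.hQQ.symm)

theorem no16 (S : S36 C Q h) (q : N) (hq : q ∈ Q) (h1 : q ≠ 1)
    (h16 : Nat.card {P : Sylow 5 N // (MulAut.conj q * h) • P = P} = 16) : False := by
  have := C.finN
  have hc := S.cnt q hq h1
  rw [h16] at hc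
  have hd : Nat.card (fixSub (MulAut.conj q * h)) ∣ 720 := C.cardN ▸ Subgroup.card_subgroup_dvd_card _
  rw [← hc] at hd
  have h5 : Nat.card (Subgroup.centralizer (Q : Set N)) = 5 := by
    rcases C.c5 Q S.m20 with h | h
    · exact h
    · rw [h] at hd
      omega
  set M := Subgroup.normalizer (Q : Set N) with hM
  let orb := {r : N // ∃ n ∈ M, n * q * n⁻¹ = r}
  have hch : ∀ o : orb, ∃ n ∈ M, n * q * n⁻¹ = o.1 := fun o => o.2
  choose n hnM hn using hch
  have horbQ : ∀ o : orb, o.1 ∈ Q := fun o => by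
    rw [← hn o]
    exact (Subgroup.mem_normalizer_iff.1 (hnM o) q).1 hq
  have c1 : 20 ≤ Nat.card orb * 5 := by
    rw [← h5, ← S.m20, ← Nat.card_prod]
    refine Nat.card_le_card_of_injective (fun m : M =>
      ((⟨m * q * (m : N)⁻¹, m, m.2, rfl⟩ : orb),
        (⟨(n ⟨m * q * (m : N)⁻¹, m, m.2, rfl⟩)⁻¹ * m, ?_⟩ : Subgroup.centralizer (Q : Set N)))) ?_
    · rw [← C.cent_iff Q q hq h1]
      have := hn ⟨m * q * (m : N)⁻¹, m, m.2, rfl⟩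
      generalize n _ = k at this ⊢
      have this : k * q * k⁻¹ = m * q * (m : N)⁻¹ := this
      have h2 : k⁻¹ * (m * q * (m : N)⁻¹) * m = q * k⁻¹ * m := by rw [← this]; group
      rw [← mul_assoc, ← h2]; group
    · intro m m' hmm
      rw [Prod.ext_iff] at hmm
      obtain ⟨ha, hb⟩ := hmm
      have hb := congrArg Subtype.val hb
      simp only at ha hb
      rw [ha] at hb
      exact Subtype.ext (mul_left_cancel hb)
  have hfixQ : ∀ m ∈ M, m • Q = Q := fun m hm => Sylow.smul_eq_iff_mem_normalizer.2 hm
  have c2 : Nat.card orb * Nat.card {P : Sylow 5 N // (MulAut.conj q * h) • P = P ∧ P ≠ Q} ≤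
      Nat.card {P : Sylow 5 N // True ∧ P ≠ Q} := by
    rw [← Nat.card_prod]
    have hfx : ∀ o : orb, ∀ P : Sylow 5 N, (MulAut.conj q * h) • P = P →
        (MulAut.conj o.1 * h) • (n o • P) = n o • P := by
      intro o P hP
      rw [← hn o]
      conv_rhs => rw [← hP]
      rw [Sylow.smul_def, Sylow.smul_def, ← mul_smul, ← mul_smul, mul_assoc,
        conj_fix h _ (S.hM _ (hnM o)), ← mul_assoc, ← mul_assoc, ← map_mul, ← map_mul]
      congr 3
      group
    have hneq : ∀ o : orb, ∀ P : Sylow 5 N, P ≠ Q → n o • P ≠ Q := by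
      intro o P hP hP'
      exact hP (smul_left_cancel _ (hP'.trans (hfixQ _ (hnM o)).symm))
    refine Nat.card_le_card_of_injective (fun z =>
      (⟨n z.1 • z.2.1, trivial, hneq _ _ z.2.2.2⟩ : {P : Sylow 5 N // True ∧ P ≠ Q})) ?_
    rintro ⟨o, P⟩ ⟨o', P'⟩ hz
    have hz : n o • P.1 = n o' • P'.1 := congrArg Subtype.val hz
    have ho : o = o' := by
      apply Subtype.ext
      refine S.disj o.1 o'.1 (horbQ o) (horbQ o') (n o • P.1) (hfx _ _ P.2.1) ?_ (hneq _ _ P.2.2)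
      rw [hz]
      exact hfx _ _ P'.2.1
    subst ho
    exact Prod.ext rfl (Subtype.ext (smul_left_cancel _ hz))
  have c3 := cardne (fun P : Sylow 5 N => (MulAut.conj q * h) • P = P) Q
    (smul_eq_of_fix _ Q (S.kQ q hq))
  have c4 := cardne (fun P : Sylow 5 N => True) Q trivial
  have c5 : Nat.card {P : Sylow 5 N // True} = 36 := by
    rw [← S.n36]; exact Nat.card_congr (Equiv.subtypeUnivEquiv fun _ => trivial)
  rw [h16] at c3
  rw [c5] at c4
  have c6 : Nat.card {P : Sylow 5 N // (MulAut.conj q * h) • P = P ∧ P ≠ Q} = 15 := by omega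
  rw [c6] at c2
  omega

theorem all_of_card (S : S36 C Q h) (k : MulAut N)
    (hk : Nat.card {P : Sylow 5 N // k • P = P} = 36) (P : Sylow 5 N) : k • P = P := by
  have := C.finN
  have h1 := cardcompl (fun P : Sylow 5 N => k • P = P)
  rw [hk, S.n36] at h1
  have h2 : Nat.card {P : Sylow 5 N // ¬ k • P = P} = 0 := by omega
  rw [Finite.card_eq_zero_iff] at h2
  by_contra h3
  exact h2.false ⟨P, h3⟩

theorem dich (S : S36 C Q h) (q : N) (hq : q ∈ Q) (h1 : q ≠ 1) :
    (∀ P : Sylow 5 N, (MulAut.conj q * h) • P = P) ∨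
      ∀ P : Sylow 5 N, (MulAut.conj q * h) • P = P → P = Q := by
  have := C.finN
  have hm := S.mod5 q hq
  have hc := S.cnt q hq h1
  have hd : Nat.card (fixSub (MulAut.conj q * h)) ∣ 720 := C.cardN ▸ Subgroup.card_subgroup_dvd_card _
  rw [← hc] at hd
  have h6 := S.no6 q hq h1
  have h16 := S.no16 q hq h1
  have hle : Nat.card {P : Sylow 5 N // (MulAut.conj q * h) • P = P} ≤ 36 := by
    rw [← S.n36]; exact Finite.card_subtype_le _
  have h36 := S.all_of_card (MulAut.conj q * h)
  have hQm := cardne (fun P : Sylow 5 N => (MulAut.conj q * h) • P = P) Q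
    (smul_eq_of_fix _ Q (S.kQ q hq))
  by_cases h36' : Nat.card {P : Sylow 5 N // (MulAut.conj q * h) • P = P} = 36
  · left; exact h36 h36'
  right
  have hd' : Nat.card {P : Sylow 5 N // (MulAut.conj q * h) • P = P} ∣ 720 :=
    Dvd.dvd.trans ⟨_, rfl⟩ hd
  have hone : Nat.card {P : Sylow 5 N // (MulAut.conj q * h) • P = P} = 1 := by
    clear hQm h36 hd hc
    generalize Nat.card {P : Sylow 5 N // (MulAut.conj q * h) • P = P} = m at *
    interval_cases m <;> first | omega | exact (h6 rfl).elim | exact (h16 rfl).elim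
  rw [hone] at hQm
  have h2 : Nat.card {P : Sylow 5 N // (MulAut.conj q * h) • P = P ∧ P ≠ Q} = 0 := by omega
  rw [Finite.card_eq_zero_iff] at h2
  intro P hP
  by_contra h3
  exact h2.false ⟨P, hP, h3⟩

theorem free (S : S36 C Q h) (hF : ∀ q ∈ Q, q ≠ 1 → ∀ P : Sylow 5 N,
    (MulAut.conj q * h) • P = P → P = Q) : ∀ P : Sylow 5 N, h • P = P := by
  have := C.finN
  have hp : Fact (Nat.Prime 5) := ⟨by norm_num⟩
  have : Finite (MulAut N) := inferInstance
  by_cases hh1 : h = 1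
  · intro P; rw [hh1, one_smul]
  have hcz : Nat.card (Subgroup.zpowers h) = 5 := by
    rw [Nat.card_zpowers, orderOf_eq_prime S.h5 hh1]
  have hcomm : ∀ (x : Q) (y : Subgroup.zpowers h),
      Commute ((MulAut.conj (G := N)).comp (Q : Subgroup N).subtype x)
        ((Subgroup.zpowers h).subtype y) := by
    rintro ⟨x, hx⟩ ⟨_, i, rfl⟩
    have : Commute (MulAut.conj x) h := C.commh Q h S.hQ x hx
    exact this.zpow_right i
  let ψ : Q × Subgroup.zpowers h →* MulAut N := MonoidHom.noncommCoprod _ _ hcomm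
  have hψ : ∀ e, ψ e = MulAut.conj (e.1 : N) * (e.2 : MulAut N) := fun e => rfl
  have hψh : ∀ e, ψ e * h = h * ψ e := by
    rintro ⟨⟨x, hx⟩, ⟨_, i, rfl⟩⟩
    rw [hψ]
    have h1 : Commute (MulAut.conj x) h := C.commh Q h S.hQ x hx
    have h2 : Commute (h ^ i) h := (Commute.refl h).zpow_left i
    exact h1.mul_left h2
  let X := {P : Sylow 5 N // ¬ h • P = P}
  let act : MulAction (Q × Subgroup.zpowers h) X :=
    { smul := fun e P => ⟨ψ e • P.1, by
        intro h1
        rw [← mul_smul, ← hψh, mul_smul] at h1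
        exact P.2 (smul_left_cancel _ h1)⟩
      one_smul := fun P => Subtype.ext (by
        change ψ 1 • P.1 = P.1
        rw [map_one, one_smul])
      mul_smul := fun e e' P => Subtype.ext (by
        change ψ (e * e') • P.1 = ψ e • ψ e' • P.1
        rw [map_mul, mul_smul]) }
  have hst : ∀ P : X, MulAction.stabilizer (Q × Subgroup.zpowers h) P = ⊥ := by
    rintro ⟨P, hP⟩
    rw [eq_bot_iff]
    rintro ⟨⟨x, hx⟩, ⟨k, hk⟩⟩ he
    have he : (MulAut.conj x * k) • P = P := congrArg Subtype.val he
    have hPQ : P ≠ Q := by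
      rintro rfl
      exact hP S.hQQ
    rw [Subgroup.mem_bot]
    by_cases hk1 : k = 1
    · subst hk1
      by_cases hx1 : x = 1
      · subst hx1; rfl
      · exfalso
        rw [mul_one] at he
        exact hPQ (C.selfnorm Q P x hx hx1 he)
    · exfalso
      have hzk : h ∈ Subgroup.zpowers k := by
        have h3 : (⟨h, Subgroup.mem_zpowers h⟩ : Subgroup.zpowers h) ∈
            Subgroup.zpowers (⟨k, hk⟩ : Subgroup.zpowers h) :=
          mem_zpowers_of_prime_card hcz (fun h4 => hk1 (congrArg Subtype.val h4))
        obtain ⟨j, hj⟩ := h3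
        exact ⟨j, congrArg Subtype.val hj⟩
      obtain ⟨j, hj⟩ := hzk
      have hj : k ^ j = h := hj
      have hco : Commute (MulAut.conj x) k := by
        obtain ⟨i, rfl⟩ := hk
        have : Commute (MulAut.conj x) h := C.commh Q h S.hQ x hx
        exact this.zpow_right i
      have h5 : (MulAut.conj (x ^ j) * h) • P = P := by
        rw [map_zpow, ← hj, ← hco.mul_zpow]
        have : MulAut.conj x * k ∈ MulAction.stabilizer (MulAut N) P := he
        exact Subgroup.zpow_mem _ this j
      by_cases hxj : x ^ j = 1
      · rw [hxj, map_one, one_mul] at h5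
        exact hP h5
      · exact hPQ (hF _ (Subgroup.zpow_mem _ hx j) hxj P h5)
  have hX := Nat.card_congr (MulAction.selfEquivOrbitsQuotientProd hst)
  rw [Nat.card_prod, Nat.card_prod, hcz] at hX
  change Nat.card X = _ * (Nat.card Q * 5) at hX
  rw [C.cardQ Q] at hX
  have h1 := cardcompl (fun P : Sylow 5 N => h • P = P)
  change _ + Nat.card X = _ at h1
  rw [S.n36, hX] at h1
  apply S.all_of_card
  have hd := C.fixdata Q h S.h5 S.hQ
  have hd2 : Nat.card (fixSub h) ∣ 720 := C.cardN ▸ Subgroup.card_subgroup_dvd_card _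
  have hd3 : Nat.card {P : Sylow 5 N // h • P = P} ∣ 720 := Dvd.dvd.trans ⟨_, hd.symm⟩ hd2
  generalize Nat.card {P : Sylow 5 N // h • P = P} = m at *
  generalize Nat.card (MulAction.orbitRel.Quotient (Q × Subgroup.zpowers h) X) = w at *
  have hw : w = 0 ∨ w = 1 := by omega
  rcases hw with rfl | rfl
  · omega
  · have : m = 11 := by omega
    subst this
    omega

theorem concl (S : S36 C Q h) : ∃ q ∈ Q, ∀ P : Sylow 5 N, (MulAut.conj q * h) • P = P := by
  by_cases hF : ∀ q ∈ Q, q ≠ 1 → ∀ P : Sylow 5 N, (MulAut.conj q * h) • P = P → P = Q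
  · refine ⟨1, Q.one_mem, ?_⟩
    rw [map_one, one_mul]
    exact S.free hF
  · push Not at hF
    obtain ⟨q, hq, h1, P, hP, hPQ⟩ := hF
    rcases S.dich q hq h1 with h2 | h2
    · exact ⟨q, hq, h2⟩
    · exact (hPQ (h2 P hP)).elim
end S36

theorem case36 (C : Cfg A N) (h : Nat.card (Sylow 5 N) = 36) :
    ∀ a, ∃ n, C.la a = MulAut.conj n := by
  have := C.finN
  obtain ⟨a, ha, h5, Q, hQ⟩ := C.start
  have hM : Nat.card (Subgroup.normalizer (Q : Set N)) = 20 := by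
    have := C.n5.2 Q
    rw [h] at this
    omega
  obtain ⟨r, hr, hrM⟩ := C.fixM Q _ h5 hQ hM
  have S : S36 C Q (MulAut.conj r * C.la a) := ⟨h, C.hq5 Q _ h5 hQ r hr, hrM⟩
  obtain ⟨q, hq, hall⟩ := S.concl
  have h6 := S.k5 q hq
  rw [← mul_assoc, ← map_mul] at h6
  refine C.finishO a ha (q * r) h6 ?_ Q
  intro P
  have := hall P
  rw [← mul_assoc, ← map_mul] at this
  exact this

theorem inner (C : Cfg A N) : ∀ a, ∃ n, C.la a = MulAut.conj n := by
  rcases C.n5.1 with h | h | h | h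
  · exact (C.case1 h).elim
  · exact C.case6 h
  · exact (C.case16 h).elim
  · exact C.case36 h
end Cfg

abbrev S6 := Equiv.Perm (Fin 6)

structure RS (N : Type) [Group N] where
  c : S6 → N
  bij : Function.Bijective c
  mu : S6 →* MulAut N
  coc : ∀ s t, c (s * t) = mu s (c t) * c s

def y4 : S6 := c[0, 1, 2, 3] * c[4, 5]

theorem conjP {y : S6} (hs : Equiv.Perm.sign y = 1) (h4 : y ^ 4 = 1) (h2 : y ^ 2 ≠ 1) :
    ∃ k : S6, Equiv.Perm.sign k = 1 ∧ k * y4 * k⁻¹ = y := by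
  have hct : ∀ y : S6, Equiv.Perm.sign y = 1 → y ^ 4 = 1 → y ^ 2 ≠ 1 →
      y.cycleType = 4 ::ₘ 2 ::ₘ 0 := by
    clear hs h4 h2 y
    intro y hs h4 h2
    have hd : ∀ n ∈ y.cycleType, n = 2 ∨ n = 4 := by
      intro n hn
      have h1 := Equiv.Perm.two_le_of_mem_cycleType hn
      have h3 : n ∣ 4 := (Equiv.Perm.dvd_of_mem_cycleType hn).trans (orderOf_dvd_of_pow_eq_one h4)
      have := Nat.le_of_dvd (by norm_num) h3
      interval_cases n <;> omega
    have h4m : 4 ∈ y.cycleType := by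
      by_contra h
      apply h2
      rw [← orderOf_dvd_iff_pow_eq_one, ← Equiv.Perm.lcm_cycleType, Multiset.lcm_dvd]
      intro n hn
      rcases hd n hn with rfl | rfl
      · exact dvd_rfl
      · exact (h hn).elim
    obtain ⟨m, hm⟩ := Multiset.exists_cons_of_mem h4m
    have hsum : y.cycleType.sum ≤ 6 := by
      rw [Equiv.Perm.sum_cycleType]
      exact (Finset.card_le_univ _).trans (by simp)
    rw [Equiv.Perm.sign_of_cycleType] at hs
    rw [hm] at hs hsum hd ⊢
    by_cases hm0 : m = 0
    · subst hm0
      exfalso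
      revert hs
      simp
      decide
    · obtain ⟨n, hn⟩ := Multiset.exists_mem_of_ne_zero hm0
      obtain ⟨m', rfl⟩ := Multiset.exists_cons_of_mem hn
      simp only [Multiset.sum_cons] at hsum
      have hn2 : n = 2 := by
        rcases hd n (by simp) with h | h <;> omega
      subst hn2
      by_cases hm0' : m' = 0
      · rw [hm0']
      · obtain ⟨n, hn⟩ := Multiset.exists_mem_of_ne_zero hm0'
        obtain ⟨m', rfl⟩ := Multiset.exists_cons_of_mem hn
        simp only [Multiset.sum_cons] at hsum
        rcases hd n (by simp) with h | h <;> omega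
  have h1 := hct y4 (by decide) (by decide) (by decide)
  have h3 := hct y hs h4 h2
  obtain ⟨k, hk⟩ := isConj_iff.1 (Equiv.Perm.isConj_iff_cycleType_eq.2 (h1.trans h3.symm))
  rcases Int.units_eq_one_or (Equiv.Perm.sign k) with h | h
  · exact ⟨k, h, hk⟩
  · refine ⟨k * c[4, 5], ?_, ?_⟩
    · rw [map_mul, h]; decide
    · rw [← hk]
      have : (c[4,5] : S6) * y4 * c[4,5]⁻¹ = y4 := by decide
      conv_rhs => rw [← this]
      group

theorem memA {s : S6} (h : Equiv.Perm.sign s = 1) : s ∈ alternatingGroup (Fin 6) :=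
  Equiv.Perm.mem_alternatingGroup.2 h

theorem exnc : ∃ a b : alternatingGroup (Fin 6), a * b ≠ b * a := by
  refine ⟨⟨c[0, 1, 2], memA (by decide)⟩, ⟨c[1, 2, 3], memA (by decide)⟩, ?_⟩
  intro h
  have := congrArg Subtype.val h
  revert this
  decide

namespace RS
variable {N : Type} [Group N]

theorem c1 (R : RS N) : R.c 1 = 1 := by
  have := R.coc 1 1
  rw [map_one, mul_one, MulAut.one_apply] at this
  exact left_eq_mul.1 this

theorem conj_mu (f : MulAut N) (x : N) : MulAut.conj (f x) = f * MulAut.conj x * f⁻¹ := by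
  ext z
  simp [MulAut.conj_apply, MulAut.mul_apply, MulAut.inv_def]

def lam (R : RS N) : S6 →* MulAut N where
  toFun s := (MulAut.conj (R.c s))⁻¹ * R.mu s
  map_one' := by rw [R.c1, map_one, map_one, inv_one, mul_one]
  map_mul' s t := by
    rw [R.coc, map_mul, map_mul, conj_mu]
    group

theorem mu_eq (R : RS N) (s : S6) : R.mu s = MulAut.conj (R.c s) * R.lam s := by
  change _ = _ * ((MulAut.conj (R.c s))⁻¹ * R.mu s)
  group

theorem lam_coc (R : RS N) (s t : S6) : R.c (s * t) = R.c s * R.lam s (R.c t) := by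
  rw [R.coc, R.mu_eq]
  simp [MulAut.conj_apply, MulAut.mul_apply]

theorem center_of (R : RS N) (z : S6) (h : R.mu z = R.lam z) : R.c z ∈ Subgroup.center N := by
  rw [mu_eq] at h
  have h := mul_eq_right.1 h
  rw [Subgroup.mem_center_iff]
  intro g
  have h := DFunLike.congr_fun h g
  rw [MulAut.conj_apply, MulAut.one_apply, mul_inv_eq_iff_eq_mul] at h
  exact h.symm

theorem cardN (R : RS N) : Nat.card N = 720 := by
  rw [← Nat.card_congr (Equiv.ofBijective _ R.bij), Nat.card_perm]
  simp [Nat.factorial]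

theorem inj_of (f : S6 →* MulAut N) (h : ¬ ∀ k ∈ alternatingGroup (Fin 6), f k = 1) :
    Function.Injective (f.comp (alternatingGroup (Fin 6)).subtype) := by
  have := alternatingGroup.isSimpleGroup (α := Fin 6) (by simp)
  rw [← MonoidHom.ker_eq_bot_iff]
  rcases Subgroup.Normal.eq_bot_or_eq_top
    (MonoidHom.normal_ker (f.comp (alternatingGroup (Fin 6)).subtype)) with h1 | h1
  · exact h1
  · refine (h fun k hk => ?_).elim
    have : (⟨k, hk⟩ : alternatingGroup (Fin 6)) ∈
      (f.comp (alternatingGroup (Fin 6)).subtype).ker := h1 ▸ Subgroup.mem_top _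
    exact this

theorem main (R : RS N) : (∀ k ∈ alternatingGroup (Fin 6), R.mu k = 1) ∨
    ∀ k ∈ alternatingGroup (Fin 6), R.lam k = 1 := by
  by_contra hcon
  push Not at hcon
  have hmi := inj_of R.mu (by push Not; exact hcon.1)
  have hli := inj_of R.lam (by push Not; exact hcon.2)
  have cA : Nat.card (alternatingGroup (Fin 6)) = 360 := by
    rw [nat_card_alternatingGroup]; simp [Nat.factorial]
  have cN := R.cardN
  have hfin : Finite N := Nat.finite_of_card_ne_zero (by rw [cN]; norm_num)
  let A := alternatingGroup (Fin 6)
  let la : A →* MulAut N := R.lam.comp A.subtype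
  let C : Cfg A N := {
    la := la
    c := fun a => R.c a
    inj := hli
    cinj := fun a b h => Subtype.ext (R.bij.1 h)
    coc := fun a b => R.lam_coc a b
    cardA := cA
    cardN := cN
    simple := alternatingGroup.isSimpleGroup (by simp)
    nc := exnc }
  have hin : ∀ a : A, ∃ n, la a = MulAut.conj n := C.inner
  choose f hf using hin
  have hZ : 360 * Nat.card (Subgroup.center N) ≤ 720 := by
    rw [← cA, ← cN, ← Nat.card_prod]
    refine Nat.card_le_card_of_injective (fun p : A × Subgroup.center N => f p.1 * p.2.1) ?_
    rintro ⟨a, z⟩ ⟨a', z'⟩ h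
    have h : f a * z.1 = f a' * z'.1 := h
    have hz : ∀ z : Subgroup.center N, MulAut.conj z.1 = 1 := by
      intro z
      ext g
      rw [MulAut.conj_apply, MulAut.one_apply, mul_inv_eq_iff_eq_mul]
      exact (Subgroup.mem_center_iff.1 z.2 g).symm
    have h1 := congrArg MulAut.conj h
    rw [map_mul, map_mul, hz, hz, mul_one, mul_one, ← hf, ← hf] at h1
    have h1 := hli h1
    subst h1
    exact Prod.ext rfl (Subtype.ext (mul_left_cancel h))
  let M : Subgroup N := la.range.comap MulAut.conj
  have hM : 360 ≤ Nat.card M := by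
    rw [← cA]
    refine Nat.card_le_card_of_injective
      (fun a : A => (⟨f a, a, hf a⟩ : M)) ?_
    intro a b h
    have h : f a = f b := congrArg Subtype.val h
    apply hli
    change la a = la b
    rw [hf, hf, h]
  have hMi : M.index = 1 ∨ M.index = 2 := by
    have h1 := M.card_mul_index
    rw [cN] at h1
    have h2 : M.index ≤ 2 := by
      by_contra h3
      push Not at h3
      nlinarith
    have h3 : M.index ≠ 0 := by
      intro h; rw [h] at h1; omega
    omega
  have hsq : ∀ n : N, n ^ 2 ∈ M := by
    intro n
    rcases hMi with h | h
    · rw [Subgroup.index_eq_one.1 h]; trivial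
    · exact Subgroup.sq_mem_of_index_two h n
  have hmusq : ∀ x ∈ A, R.mu (x ^ 2) ∈ la.range := by
    intro x hx
    have : R.mu x = MulAut.conj (R.c x * f ⟨x, hx⟩) := by
      rw [map_mul, ← hf]
      exact R.mu_eq x
    rw [map_pow, this, ← map_pow]
    exact hsq _
  have hmuy : R.mu y4 ∈ la.range := by
    have : y4 = (c[0, 1, 4] : S6) ^ 2 * (c[0, 5, 4] : S6) ^ 2 * (c[1, 3, 2] : S6) ^ 2 := by decide
    rw [this, map_mul, map_mul]
    exact mul_mem (mul_mem (hmusq _ (memA (by decide))) (hmusq _ (memA (by decide)))) (hmusq _ (memA (by decide)))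
  obtain ⟨y', hy'⟩ := hmuy
  have h4 : y' ^ 4 = 1 := by
    apply hli
    change la (y' ^ 4) = la 1
    rw [map_pow, hy', ← map_pow, map_one]
    have : y4 ^ 4 = 1 := by decide
    rw [this, map_one]
  have h2 : y' ^ 2 ≠ 1 := by
    intro h
    have h1 := congrArg la h
    rw [map_pow, hy', ← map_pow, map_one] at h1
    have h3 := @hmi ⟨y4 ^ 2, memA (by decide)⟩ 1 (h1.trans (map_one _).symm)
    have h3 := congrArg Subtype.val h3
    revert h3
    decide
  obtain ⟨k, hk, hky⟩ := conjP (y := y') (Equiv.Perm.mem_alternatingGroup.1 y'.2)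
    (congrArg Subtype.val h4) (fun h => h2 (Subtype.ext h))
  obtain ⟨v, hv⟩ := R.bij.2 (f ⟨k, Equiv.Perm.mem_alternatingGroup.2 hk⟩)
  have hlk : R.lam k = MulAut.conj (R.c v) := by
    rw [hv, ← hf]; rfl
  have hmy : R.mu y4 = MulAut.conj (R.c v) * R.lam y4 * (MulAut.conj (R.c v))⁻¹ := by
    rw [← hlk, ← map_inv, ← map_mul, ← map_mul, hky]
    exact hy'.symm
  have hcv : MulAut.conj (R.c v) = (R.mu v⁻¹)⁻¹ * R.lam v⁻¹ := by
    have h1 := R.coc v v⁻¹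
    rw [mul_inv_cancel, R.c1] at h1
    have h2 := congrArg MulAut.conj h1
    rw [map_one, map_mul, conj_mu] at h2
    have h3 : MulAut.conj (R.c v⁻¹) = R.mu v⁻¹ * (R.lam v⁻¹)⁻¹ := by
      rw [R.mu_eq v⁻¹]; group
    have h4 := (eq_inv_of_mul_eq_one_right h2.symm)
    rw [h4, h3, map_inv R.mu]
    group
  generalize v⁻¹ = u at *
  have hz : R.mu (u * y4 * u⁻¹) = R.lam (u * y4 * u⁻¹) := by
    rw [map_mul, map_mul, map_mul, map_mul, hmy, hcv, map_inv, map_inv]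
    group
  set z := u * y4 * u⁻¹ with hzdef
  have hzo : orderOf z = 4 := by
    have : orderOf y4 = 4 := by
      rw [show 4 = 2 ^ (1 + 1) from rfl]
      exact orderOf_eq_prime_pow (by decide) (by decide)
    rw [← this, hzdef]
    exact (MulEquiv.orderOf_eq (MulAut.conj u) y4)
  have : 4 ≤ Nat.card (Subgroup.center N) := by
    rw [← hzo, ← Nat.card_zpowers]
    refine Nat.card_le_card_of_injective
      (fun a : Subgroup.zpowers z => (⟨R.c a.1, R.center_of _ ?_⟩ : Subgroup.center N)) ?_
    · obtain ⟨_, i, rfl⟩ := a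
      change R.mu (z ^ i) = R.lam (z ^ i)
      rw [map_zpow, map_zpow, hz]
    · intro a b h
      exact Subtype.ext (R.bij.1 (congrArg Subtype.val h))
  omega
end RS

namespace Cl
open Equiv.Perm (sign)

theorem papp {α : Type} (f : Equiv.Perm α) (x : α) : f (f⁻¹ x) = x := Equiv.apply_symm_apply f x

theorem mlapp (a b : S6) : Equiv.mulLeft a b = a * b := rfl

theorem sign_aut (θ : MulAut S6) (s : S6) : sign (θ s) = sign s := by
  have h : Function.Surjective (sign.comp θ.toMonoidHom : S6 →* ℤˣ) :=
    (Equiv.Perm.sign_surjective (Fin 6)).comp θ.surjective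
  exact DFunLike.congr_fun (Equiv.Perm.eq_sign_of_surjective_hom h) s

def ee (θ : MulAut S6) (s : S6) : MulAut S6 := if sign s = 1 then 1 else θ

theorem sgn_cases (s : S6) : sign s = 1 ∨ sign s = -1 := Int.units_eq_one_or _

theorem ee_even {θ : MulAut S6} {s : S6} (h : sign s = 1) : ee θ s = 1 := if_pos h
theorem ee_odd {θ : MulAut S6} {s : S6} (h : sign s = -1) : ee θ s = θ := by
  rw [ee, h]; exact if_neg (by decide)
theorem ee_sign {θ : MulAut S6} {s t : S6} (h : sign s = sign t) : ee θ s = ee θ t := by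
  rw [ee, ee, h]
theorem sign_ee (θ : MulAut S6) (s t : S6) : sign (ee θ s t) = sign t := sign_aut _ _

theorem ee_mul {θ : MulAut S6} (hθ : θ * θ = 1) (s t : S6) : ee θ (s * t) = ee θ s * ee θ t := by
  rcases sgn_cases s with hs | hs <;> rcases sgn_cases t with ht | ht
  · rw [ee_even hs, ee_even ht, ee_even (by rw [map_mul, hs, ht]; rfl), mul_one]
  · rw [ee_even hs, ee_odd ht, ee_odd (by rw [map_mul, hs, ht]; rfl), one_mul]
  · rw [ee_odd hs, ee_even ht, ee_odd (by rw [map_mul, hs, ht]; rfl), mul_one]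
  · rw [ee_odd hs, ee_odd ht, ee_even (by rw [map_mul, hs, ht]; rfl), hθ]

theorem ee_one (θ : MulAut S6) : ee θ 1 = 1 := ee_even (map_one _)

abbrev TT := {θ : MulAut S6 // θ * θ = 1}

def Rs (θ : TT) : Subgroup (Equiv.Perm S6) where
  carrier := {η | ∀ τ, η τ = τ * ee θ.1 τ (η 1)}
  mul_mem' := by
    intro η ζ hη hζ τ
    rw [Equiv.Perm.mul_apply, Equiv.Perm.mul_apply, hη (ζ τ), hη (ζ 1), hζ τ, map_mul,
      ee_mul θ.2, ee_sign (sign_ee θ.1 τ (ζ 1)), MulAut.mul_apply, mul_assoc]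
  one_mem' := by
    intro τ
    rw [Equiv.Perm.one_apply, Equiv.Perm.one_apply, map_one, mul_one]
  inv_mem' := by
    intro η hη τ
    rw [Equiv.Perm.inv_eq_iff_eq, hη (τ * _), ee_mul θ.2, ee_sign (sign_ee θ.1 τ (η⁻¹ 1)),
      MulAut.mul_apply, mul_assoc, ← map_mul, ← hη, papp, map_one, mul_one]

def Ls (θ : TT) : Subgroup (Equiv.Perm S6) where
  carrier := {η | ∀ τ, η τ = η 1 * ee θ.1 (η 1) τ}
  mul_mem' := by
    intro η ζ hη hζ τ
    rw [Equiv.Perm.mul_apply, Equiv.Perm.mul_apply, hη (ζ τ), hη (ζ 1), hζ τ, map_mul,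
      ee_mul θ.2, ee_sign (sign_ee θ.1 _ (ζ 1)), MulAut.mul_apply, mul_assoc]
  one_mem' := by
    intro τ
    rw [Equiv.Perm.one_apply, Equiv.Perm.one_apply, ee_one, one_mul, MulAut.one_apply]
  inv_mem' := by
    intro η hη τ
    have h1 := hη (η⁻¹ 1)
    rw [papp] at h1
    rw [Equiv.Perm.inv_eq_iff_eq, hη (_ * _), map_mul, ← mul_assoc, ← h1, one_mul,
      ← MulAut.mul_apply, ← ee_mul θ.2, ee_even, MulAut.one_apply]
    have h2 := congrArg sign h1
    rw [map_one, map_mul, sign_ee] at h2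
    rw [map_mul, ← h2]

theorem eq_of_le_reg {H K : Subgroup (Equiv.Perm S6)} (hH : IsRegularSubgroup H)
    (hK : IsRegularSubgroup K) (h : H ≤ K) : H = K := by
  apply le_antisymm h
  intro k hk
  obtain ⟨η, hη⟩ := hH.2 (k 1)
  have := @hK.1 ⟨η.1, h η.2⟩ ⟨k, hk⟩ hη
  have this : η.1 = k := congrArg Subtype.val this
  rw [← this]; exact η.2

theorem Rs_reg (θ : TT) : IsRegularSubgroup (Rs θ) := by
  constructor
  · rintro ⟨η, hη⟩ ⟨ζ, hζ⟩ h
    have h : η 1 = ζ 1 := h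
    apply Subtype.ext
    ext1 τ
    change η τ = ζ τ
    rw [hη τ, hζ τ, h]
  · intro σ
    have hb : Function.Bijective (fun τ => τ * ee θ.1 τ σ) := by
      rw [← Finite.injective_iff_bijective]
      intro a b h
      have h : a * ee θ.1 a σ = b * ee θ.1 b σ := h
      have h2 := congrArg sign h
      rw [map_mul, map_mul, sign_ee, sign_ee] at h2
      rw [ee_sign (mul_right_cancel h2)] at h
      exact mul_right_cancel h
    have h1 : (Equiv.ofBijective _ hb) 1 = σ := by
      change 1 * ee θ.1 1 σ = σ
      rw [ee_one, one_mul, MulAut.one_apply]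
    refine ⟨⟨Equiv.ofBijective _ hb, ?_⟩, h1⟩
    intro τ
    rw [h1]
    rfl

theorem Ls_reg (θ : TT) : IsRegularSubgroup (Ls θ) := by
  constructor
  · rintro ⟨η, hη⟩ ⟨ζ, hζ⟩ h
    have h : η 1 = ζ 1 := h
    apply Subtype.ext
    ext1 τ
    change η τ = ζ τ
    rw [hη τ, hζ τ, h]
  · intro σ
    let η : Equiv.Perm S6 := (ee θ.1 σ).toEquiv.trans (Equiv.mulLeft σ)
    have h : ∀ τ, η τ = σ * ee θ.1 σ τ := fun τ => rfl
    have h1 : η 1 = σ := by rw [h, map_one, mul_one]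
    refine ⟨⟨η, ?_⟩, h1⟩
    intro τ
    rw [h1, h]

theorem conj_app (σ : S6) (η : Equiv.Perm S6) (τ : S6) :
    (Equiv.mulLeft σ * η * (Equiv.mulLeft σ)⁻¹) τ = σ * η (σ⁻¹ * τ) := by
  rw [Equiv.Perm.mul_apply, Equiv.Perm.mul_apply]
  have : (Equiv.mulLeft σ)⁻¹ τ = σ⁻¹ * τ := by
    rw [Equiv.Perm.inv_eq_iff_eq, mlapp, mul_inv_cancel_left]
  rw [this]
  rfl

theorem Rs_norm (θ : TT) : IsNormalizedByLeft (Rs θ) := by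
  intro σ η hη τ
  rw [conj_app, conj_app, hη (σ⁻¹ * τ), hη (σ⁻¹ * 1), mul_one, mul_inv_cancel_left, ← MulAut.mul_apply, ← ee_mul θ.2,
    ee_sign (show sign (σ⁻¹ * τ) = sign (τ * σ⁻¹) by rw [map_mul, map_mul, mul_comm]), mul_assoc,
    mul_inv_cancel_left]

theorem Ls_norm (θ : TT) : IsNormalizedByLeft (Ls θ) := by
  intro σ η hη τ
  rw [conj_app, conj_app, hη (σ⁻¹ * τ), hη (σ⁻¹ * 1), mul_one, map_mul]
  rw [ee_sign (show sign (σ * (η 1 * ee θ.1 (η 1) σ⁻¹)) = sign (η 1) by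
    rw [map_mul, map_mul, sign_ee, map_inv]; 
    rw [mul_comm (sign (η 1)), mul_inv_cancel_left])]
  group

def tt : S6 := Equiv.swap 0 1
theorem tt_sign : sign tt = -1 := by decide
theorem tt_inv : tt⁻¹ = tt := by decide
theorem tt_sq : tt * tt = 1 := by decide
theorem neg_ne : (-1 : ℤˣ) ≠ 1 := by decide

theorem Rs_inj : Function.Injective Rs := by
  intro θ θ' h
  apply Subtype.ext
  ext1 σ
  obtain ⟨⟨η, hη⟩, h1⟩ := (Rs_reg θ).2 σ
  have h1 : η 1 = σ := h1
  have hη' : η ∈ Rs θ' := h ▸ hη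
  have := (hη tt).symm.trans (hη' tt)
  rw [h1, ee_odd tt_sign, ee_odd tt_sign] at this
  exact mul_left_cancel this

theorem Ls_inj : Function.Injective Ls := by
  intro θ θ' h
  apply Subtype.ext
  ext1 σ
  obtain ⟨⟨η, hη⟩, h1⟩ := (Ls_reg θ).2 tt
  have h1 : η 1 = tt := h1
  have hη' : η ∈ Ls θ' := h ▸ hη
  have := (hη σ).symm.trans (hη' σ)
  rw [h1, ee_odd tt_sign, ee_odd tt_sign] at this
  exact mul_left_cancel this

theorem Rs_ne_Ls (θ θ' : TT) : Rs θ ≠ Ls θ' := by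
  intro h
  obtain ⟨⟨a, ha⟩, ⟨b, hb⟩, hab⟩ := exnc
  apply hab
  rw [Equiv.Perm.mem_alternatingGroup] at ha hb
  obtain ⟨⟨η, hη⟩, h1⟩ := (Rs_reg θ).2 b
  have h1 : η 1 = b := h1
  have hη' : η ∈ Ls θ' := h ▸ hη
  have := (hη a).symm.trans (hη' a)
  rw [h1, ee_even ha, ee_even hb] at this
  exact Subtype.ext this

def autOf (f : S6 → S6) (hi : ∀ x, f (f x) = x) (hm : ∀ x y, f (x * y) = f x * f y) : TT :=
  ⟨{ toFun := f, invFun := f, left_inv := hi, right_inv := hi, map_mul' := hm },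
    by ext1 x; exact hi x⟩

theorem exR {H : Subgroup (Equiv.Perm S6)} (hr : IsRegularSubgroup H) (hn : IsNormalizedByLeft H)
    (hA : ∀ k, sign k = 1 → ∀ η ∈ H, ∀ τ, η (k * τ) = k * η τ) : ∃ θ, H = Rs θ := by
  choose E hE using hr.2
  have hE : ∀ σ, (E σ).1 1 = σ := hE
  have hu : ∀ η ∈ H, ∀ ζ ∈ H, η 1 = ζ 1 → η = ζ := fun η h1 ζ h2 h =>
    congrArg Subtype.val (@hr.1 ⟨η, h1⟩ ⟨ζ, h2⟩ h)
  let f : S6 → S6 := fun σ => tt * (E σ).1 tt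
  have hf : ∀ η ∈ H, f (η 1) = tt * η tt := by
    intro η hη
    have := hu (E (η 1)).1 (E (η 1)).2 η hη (hE _)
    change tt * (E (η 1)).1 tt = _
    rw [this]
  have ke : ∀ η ∈ H, ∀ τ, sign τ = 1 → η τ = τ * η 1 := by
    intro η hη τ hτ
    have := hA τ hτ η hη 1
    rwa [mul_one] at this
  have ko : ∀ η ∈ H, ∀ τ, sign τ = -1 → η τ = τ * f (η 1) := by
    intro η hη τ hτ
    have := hA (τ * tt) (by rw [map_mul, hτ, tt_sign]; rfl) η hη tt
    rw [mul_assoc, tt_sq, mul_one] at this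
    rw [this, hf η hη, mul_assoc]
  let pr : Equiv.Perm S6 → Equiv.Perm S6 := fun η => Equiv.mulLeft tt * η * (Equiv.mulLeft tt)⁻¹
  have hp : ∀ η ∈ H, pr η ∈ H := fun η hη => hn tt η hη
  have hpa : ∀ η τ, pr η τ = tt * η (tt * τ) := fun η τ => by
    rw [conj_app, tt_inv]
  have hp1 : ∀ η ∈ H, pr η 1 = f (η 1) := fun η hη => by
    rw [hpa, hf η hη, mul_one]
  have hpm : ∀ η ζ, pr (η * ζ) = pr η * pr ζ := by
    intro η ζ
    change _ = (_ * _ * _) * (_ * _ * _)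
    change _ * _ * _ = _
    group
  have hi : ∀ σ, f (f σ) = σ := by
    intro σ
    rw [← hE σ, ← hp1 _ (E σ).2, hf _ (hp _ (E σ).2), hpa, tt_sq, ← mul_assoc, tt_sq, one_mul]
  have h1 : f 1 = 1 := by
    have := hf 1 H.one_mem
    rwa [Equiv.Perm.one_apply, Equiv.Perm.one_apply, tt_sq] at this
  have hmf : ∀ σ' σ, f ((E σ).1 σ') = (pr (E σ).1) (f σ') := by
    intro σ' σ
    have h2 := hp1 ((E σ).1 * (E σ').1) (H.mul_mem (E σ).2 (E σ').2)
    rw [hpm, Equiv.Perm.mul_apply (pr _), hp1 _ (E σ').2, hE, Equiv.Perm.mul_apply (E σ).1, hE] at h2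
    exact h2.symm
  have sE : ∀ σ, sign σ = 1 → sign (f σ) = 1 := by
    intro σ hσ
    rcases sgn_cases (f σ) with h | h
    · exact h
    · have h2 := hmf σ σ⁻¹
      rw [ke _ (E _).2 _ hσ, hE, mul_inv_cancel, h1, ko _ (hp _ (E _).2) _ h, hp1 _ (E _).2, hE,
        hi] at h2
      have h3 := mul_inv_eq_one.1 h2.symm
      rw [h3]; exact hσ
  have sO : ∀ σ, sign σ = -1 → sign (f σ) = -1 := by
    intro σ hσ
    rcases sgn_cases (f σ) with h | h
    · have := sE _ h
      rw [hi, hσ] at this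
      exact (neg_ne this).elim
    · exact h
  have hm : ∀ x y, f (x * y) = f x * f y := by
    intro x y
    rcases sgn_cases x with h | h
    · have h2 := hmf x y
      rwa [ke _ (E _).2 _ h, hE, ke _ (hp _ (E _).2) _ (sE _ h), hp1 _ (E _).2, hE] at h2
    · have h2 := hmf x (f y)
      rwa [ko _ (E _).2 _ h, hE, hi, ko _ (hp _ (E _).2) _ (sO _ h), hp1 _ (E _).2, hE, hi] at h2
  refine ⟨autOf f hi hm, eq_of_le_reg hr (Rs_reg _) ?_⟩
  intro η hη τ
  rcases sgn_cases τ with h | h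
  · rw [ee_even h]; exact ke η hη τ h
  · rw [ee_odd h]; exact ko η hη τ h

theorem exL {H : Subgroup (Equiv.Perm S6)} (hr : IsRegularSubgroup H) (hn : IsNormalizedByLeft H)
    (hA : ∀ k, sign k = 1 → Equiv.mulLeft k ∈ H) : ∃ θ, H = Ls θ := by
  choose E hE using hr.2
  have hE : ∀ σ, (E σ).1 1 = σ := hE
  have hu : ∀ η ∈ H, ∀ ζ ∈ H, η 1 = ζ 1 → η = ζ := fun η h1 ζ h2 h =>
    congrArg Subtype.val (@hr.1 ⟨η, h1⟩ ⟨ζ, h2⟩ h)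
  let f : S6 → S6 := fun σ => tt * (E tt).1 σ
  have hf : ∀ σ, (E tt).1 σ = tt * f σ := by
    intro σ
    change _ = tt * (tt * _)
    rw [← mul_assoc, tt_sq, one_mul]
  have h1 : f 1 = 1 := by
    change tt * (E tt).1 1 = 1
    rw [hE, tt_sq]
  have ke : ∀ η ∈ H, sign (η 1) = 1 → ∀ τ, η τ = η 1 * τ := by
    intro η hη h τ
    have := hu η hη _ (hA _ h) (by simp)
    conv_lhs => rw [this]
    rfl
  have ko : ∀ η ∈ H, sign (η 1) = -1 → ∀ τ, η τ = η 1 * f τ := by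
    intro η hη h τ
    have := hu η hη (Equiv.mulLeft (η 1 * tt) * (E tt).1)
      (H.mul_mem (hA _ (by rw [map_mul, h, tt_sign]; rfl)) (E tt).2)
      (by rw [Equiv.Perm.mul_apply, hE, mlapp, mul_assoc, tt_sq, mul_one])
    conv_lhs => rw [this]
    rw [Equiv.Perm.mul_apply, mlapp, mul_assoc]
  have key : ∀ ρ, sign (f ρ) = sign ρ ∧ ∀ τ, f (ρ * τ) = f ρ * f τ := by
    intro ρ
    have hmem := hn ρ⁻¹ _ (E tt).2
    have hv : ∀ τ, (Equiv.mulLeft ρ⁻¹ * (E tt).1 * (Equiv.mulLeft ρ⁻¹)⁻¹) τ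
        = ρ⁻¹ * (tt * f (ρ * τ)) := by
      intro τ
      rw [conj_app, hf, inv_inv]
    generalize Equiv.mulLeft ρ⁻¹ * (E tt).1 * (Equiv.mulLeft ρ⁻¹)⁻¹ = η at hmem hv
    have hv1 := hv 1
    rw [mul_one] at hv1
    rcases sgn_cases (η 1) with h | h
    · exfalso
      have h2 := ke η hmem h ρ⁻¹
      rw [hv, mul_inv_cancel, h1, hv1, mul_one, mul_assoc, mul_assoc, mul_right_inj, left_eq_mul,
        mul_inv_eq_one] at h2
      rw [hv1, h2, map_mul, map_mul, tt_sign, map_inv] at h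
      rcases sgn_cases ρ with h3 | h3 <;> rw [h3] at h <;> exact absurd h (by decide)
    · constructor
      · rw [hv1, map_mul, map_mul, tt_sign, map_inv] at h
        rcases sgn_cases ρ with h3 | h3 <;> rcases sgn_cases (f ρ) with h4 | h4 <;>
          rw [h3, h4] at h <;> first | exact absurd h (by decide) | rw [h3, h4]
      · intro τ
        have h2 := ko η hmem h τ
        rw [hv, hv1, mul_assoc, mul_assoc, mul_right_inj, mul_right_inj] at h2
        exact h2
  have hi : ∀ x, f (f x) = x := by
    intro x
    have hv : ∀ τ, ((E tt).1 * (E tt).1) τ = tt * (f tt * f (f τ)) := by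
      intro τ
      rw [Equiv.Perm.mul_apply, hf, hf, (key tt).2]
    have hv1 := hv 1
    rw [h1, h1, mul_one] at hv1
    have h2 := ke _ (H.mul_mem (E tt).2 (E tt).2) (by
      rw [hv1, map_mul, (key tt).1, tt_sign]; rfl) x
    rw [hv1] at h2
    have h2 := (hv x).symm.trans h2
    rw [mul_assoc tt (f tt) x] at h2
    exact mul_left_cancel (mul_left_cancel h2)
  refine ⟨autOf f hi fun x y => (key x).2 y, eq_of_le_reg hr (Ls_reg _) ?_⟩
  intro η hη τ
  rcases sgn_cases (η 1) with h | h
  · rw [ee_even h]; exact ke η hη h τ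
  · rw [ee_odd h]; exact ko η hη h τ

def muH (H : Subgroup (Equiv.Perm S6)) (hn : IsNormalizedByLeft H) : S6 →* MulAut H :=
  MonoidHom.mk' (fun σ => 
    { toFun := fun η => ⟨_, hn σ η.1 η.2⟩
      invFun := fun η => ⟨_, hn σ⁻¹ η.1 η.2⟩
      left_inv := fun η => by
        apply Subtype.ext; ext1 τ
        change (Equiv.mulLeft σ⁻¹ * (Equiv.mulLeft σ * η.1 * (Equiv.mulLeft σ)⁻¹)
          * (Equiv.mulLeft σ⁻¹)⁻¹) τ = η.1 τ
        rw [conj_app, conj_app, inv_inv, inv_mul_cancel_left, inv_mul_cancel_left]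
      right_inv := fun η => by
        apply Subtype.ext; ext1 τ
        change (Equiv.mulLeft σ * (Equiv.mulLeft σ⁻¹ * η.1 * (Equiv.mulLeft σ⁻¹)⁻¹)
          * (Equiv.mulLeft σ)⁻¹) τ = η.1 τ
        rw [conj_app, conj_app, inv_inv, mul_inv_cancel_left, mul_inv_cancel_left]
      map_mul' := fun η ζ => by
        apply Subtype.ext
        change _ * (η.1 * ζ.1) * _ = (_ * _ * _) * (_ * _ * _)
        group }) (by
    intro a b
    ext1 η
    apply Subtype.ext; ext1 τ
    change (Equiv.mulLeft (a * b) * η.1 * (Equiv.mulLeft (a * b))⁻¹) τ =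
      (Equiv.mulLeft a * (Equiv.mulLeft b * η.1 * (Equiv.mulLeft b)⁻¹) * (Equiv.mulLeft a)⁻¹) τ
    rw [conj_app, conj_app, conj_app, mul_inv_rev, mul_assoc, mul_assoc])

theorem muH_app (H : Subgroup (Equiv.Perm S6)) (hn : IsNormalizedByLeft H) (σ : S6) (η : H)
    (τ : S6) : (muH H hn σ η).1 τ = σ * η.1 (σ⁻¹ * τ) := conj_app σ η.1 τ

theorem classify {H : Subgroup (Equiv.Perm S6)} (hr : IsRegularSubgroup H)
    (hn : IsNormalizedByLeft H) : (∃ θ, H = Rs θ) ∨ ∃ θ, H = Ls θ := by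
  let ev := Equiv.ofBijective _ hr
  have hev : ∀ σ, (ev.symm σ).1 1 = σ := fun σ => ev.apply_symm_apply σ
  let R : RS H :=
    { c := ev.symm
      bij := ev.symm.bijective
      mu := muH H hn
      coc := by
        intro s t
        apply hr.1
        change (ev.symm (s * t)).1 1 = ((muH H hn s (ev.symm t)).1 * (ev.symm s).1) 1
        rw [hev, Equiv.Perm.mul_apply, muH_app, hev, inv_mul_cancel, hev] }
  rcases R.main with h | h
  · left
    apply exR hr hn
    intro k hk η hη τ
    have h1 := DFunLike.congr_fun (h k (memA hk)) ⟨η, hη⟩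
    have h2 := muH_app H hn k ⟨η, hη⟩ (k * τ)
    rw [inv_mul_cancel_left, show muH H hn k ⟨η, hη⟩ = ⟨η, hη⟩ from h1] at h2
    exact h2
  · right
    apply exL hr hn
    intro k hk
    have h1 := R.mu_eq k
    rw [h k (memA hk), mul_one] at h1
    have h2 : Equiv.mulLeft k = (ev.symm k).1 := by
      ext1 x
      obtain ⟨η, hx⟩ := hr.2 x
      have hx : η.1 1 = x := hx
      have h3 := DFunLike.congr_fun h1 η
      rw [MulAut.conj_apply, eq_mul_inv_iff_mul_eq] at h3
      have h4 := DFunLike.congr_fun (congrArg Subtype.val h3) 1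
      change (muH H hn k η).1 ((ev.symm k).1 1) = (ev.symm k).1 (η.1 1) at h4
      rw [hev, muH_app, inv_mul_cancel, hx] at h4
      exact h4
    rw [h2]
    exact (ev.symm k).2

theorem count : Nat.card {H : Subgroup (Equiv.Perm S6) //
    IsRegularSubgroup H ∧ IsNormalizedByLeft H} = 2 * Nat.card TT := by
  have hb : Function.Bijective (Sum.elim
      (fun θ : TT => (⟨Rs θ, Rs_reg θ, Rs_norm θ⟩ : {H : Subgroup (Equiv.Perm S6) //
        IsRegularSubgroup H ∧ IsNormalizedByLeft H}))
      (fun θ : TT => ⟨Ls θ, Ls_reg θ, Ls_norm θ⟩)) := by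
    constructor
    · rintro (a | a) (b | b) h <;> have h := congrArg Subtype.val h
      · rw [Rs_inj h]
      · exact (Rs_ne_Ls _ _ h).elim
      · exact (Rs_ne_Ls _ _ h.symm).elim
      · rw [Ls_inj h]
    · rintro ⟨H, hr, hn⟩
      rcases classify hr hn with ⟨θ, rfl⟩ | ⟨θ, rfl⟩
      · exact ⟨Sum.inl θ, rfl⟩
      · exact ⟨Sum.inr θ, rfl⟩
  have : Finite TT := inferInstance
  rw [← Nat.card_congr (Equiv.ofBijective _ hb), Nat.card_sum, two_mul]
end Cl

namespace Ou
open Equiv.Perm (sign)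

def BB : ℕ := 2503272926264009209953219888903058680904850126481794387223378094773519860128394954742062493873456425741583192474673841809476220300881730788307677330786015293614017453494851825028664126149455898930857158841070401214323694477827962085803705423897242396720069921146808959243919458793588456197283287179960925139478991511997542640475800796408562253038422314321394921574306968844107776

def DD (a b i j : Fin 6) : Bool := Nat.testBit BB (((a.1 * 6 + b.1) * 6 + i.1) * 6 + j.1)

def W (s t : S6) : Prop := ∀ a b i j, DD (s a) (s b) (t i) (t j) = DD a b i j

instance (s t : S6) : Decidable (W s t) := by unfold W; infer_instance

theorem Dsymm : ∀ a b i j, DD a b i j = DD i j a b := by decide +kernel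

theorem Dsep : ∀ i j i' j', i ≠ j → (∀ a b, DD a b i' j' = DD a b i j) →
    (i' = i ∧ j' = j) ∨ (i' = j ∧ j' = i) := by decide +kernel

theorem Ddiag : ∀ a i j, DD a a i j = false := by decide +kernel

theorem Ddiag' : ∀ a b i, DD a b i i = false := by decide +kernel

def V (s t : S6) : Prop :=
  ∀ a b, a ≠ b → ∀ i j, i ≠ j → DD (s a) (s b) (t i) (t j) = DD a b i j

instance (s t : S6) : Decidable (V s t) := by unfold V; infer_instance

theorem W_iff_V (s t : S6) : W s t ↔ V s t := by
  constructor
  · intro h a b _ i j _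
    exact h a b i j
  · intro h a b i j
    by_cases hab : a = b
    · rw [hab, Ddiag, Ddiag]
    by_cases hij : i = j
    · rw [hij, Ddiag', Ddiag']
    exact h a b hab i j hij

theorem cardV : Fintype.card {s : S6 // V s s⁻¹} = 36 := by decide +kernel

theorem card36 : Fintype.card {s : S6 // W s s⁻¹} = 36 := by
  rw [← cardV]
  exact Fintype.card_congr (Equiv.subtypeEquivRight fun s => W_iff_V _ _)

theorem card76 : Fintype.card {s : S6 // s * s = 1} = 76 := by decide +kernel

abbrev sw (a b : Fin 6) : S6 := Equiv.swap a b

abbrev co (x y : S6) : Prop := x * y = y * x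

theorem chain : ∀ a b c p q : Fin 6, (a ≠ b ∧ b ≠ c ∧ a ≠ c ∧ p ≠ q) →
    (co (sw a b) (sw p q) ∧ ¬ co (sw b c) (sw p q) ∧ sw a b ≠ sw p q) →
    (p = c ∧ q ≠ a ∧ q ≠ b ∧ q ≠ c) ∨ (q = c ∧ p ≠ a ∧ p ≠ b ∧ p ≠ c) := by decide +kernel

theorem start : ∀ p q r s : Fin 6, (p ≠ q ∧ r ≠ s ∧ ¬ co (sw p q) (sw r s)) →
    (q = r ∧ p ≠ s) ∨ (q = s ∧ p ≠ r) ∨ (p = r ∧ q ≠ s) ∨ (p = s ∧ q ≠ r) := by decide +kernel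

theorem apart : ∀ a b c d : Fin 6, (a ≠ b ∧ c ≠ a ∧ c ≠ b ∧ c ≠ d ∧ co (sw a b) (sw c d)) →
    d ≠ a ∧ d ≠ b := by decide +kernel

theorem swc (a b : Fin 6) : sw a b = sw b a := Equiv.swap_comm a b

theorem conj_sw (s : S6) (a b : Fin 6) : s * sw a b * s⁻¹ = sw (s a) (s b) := by
  rw [mul_inv_eq_iff_eq_mul]
  exact Equiv.mul_swap_eq_swap_mul s a b

theorem ext_gen (f g : MulAut S6) (h : ∀ i : Fin 5, f (sw i.castSucc i.succ) = g (sw i.castSucc i.succ)) :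
    f = g := by
  have : f.toMonoidHom = g.toMonoidHom := by
    apply MonoidHom.eq_of_eqOn_denseM (Equiv.Perm.mclosure_swap_castSucc_succ 5)
    rintro _ ⟨i, rfl⟩
    exact h i
  ext1 x
  exact DFunLike.congr_fun this x

theorem third : ∀ a x : Fin 6, ∃ c, c ≠ a ∧ c ≠ x := by decide

theorem inj6 {a b c d e f : Fin 6} (hba : b ≠ a) (hca : c ≠ a) (hcb : c ≠ b) (hda : d ≠ a) (hdb : d ≠ b) (hdc : d ≠ c) (hea : e ≠ a) (heb : e ≠ b) (hec : e ≠ c) (hed : e ≠ d) (hfa : f ≠ a) (hfb : f ≠ b) (hfc : f ≠ c) (hfd : f ≠ d) (hfe : f ≠ e) :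
    Function.Injective ![a, b, c, d, e, f] := by
  intro i j hij
  fin_cases i <;> fin_cases j <;> first | rfl | skip
  all_goals
    simp only [Fin.zero_eta, Fin.mk_one, Fin.reduceFinMk, Matrix.cons_val_zero, Matrix.cons_val_one, Matrix.cons_val] at hij
    first | exact absurd hij (by assumption) | exact absurd hij.symm (by assumption)

theorem inner_of (θ : MulAut S6) (h : (θ (sw 0 1)).IsSwap) : ∃ s, θ = MulAut.conj s := by
  have hs : ∀ a b, a ≠ b → ∃ p q, p ≠ q ∧ θ (sw a b) = sw p q := by
    intro a b hab
    obtain ⟨p, q, hpq, h0⟩ := h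
    obtain ⟨k, hk⟩ := isConj_iff.1 (Equiv.Perm.isConj_swap (show (0 : Fin 6) ≠ 1 by decide) hab)
    have hk : k * sw 0 1 * k⁻¹ = sw a b := hk
    refine ⟨θ k p, θ k q, fun h => hpq ((θ k).injective h), ?_⟩
    rw [← hk, map_mul, map_mul, h0, map_inv, ← conj_sw]
  have key : ∀ x y, co (θ x) (θ y) ↔ co x y := by
    intro x y
    unfold co
    rw [← map_mul, ← map_mul, θ.injective.eq_iff]
  obtain ⟨a, b, c, hab, hbc, hac, h0, h1⟩ : ∃ a b c, a ≠ b ∧ b ≠ c ∧ a ≠ c ∧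
      θ (sw 0 1) = sw a b ∧ θ (sw 1 2) = sw b c := by
    obtain ⟨p, q, hpq, h0⟩ := hs 0 1 (by decide)
    obtain ⟨r, s, hrs, h1⟩ := hs 1 2 (by decide)
    have := start p q r s ⟨hpq, hrs, by rw [← h0, ← h1, key]; decide⟩
    rcases this with ⟨rfl, h⟩ | ⟨rfl, h⟩ | ⟨rfl, h⟩ | ⟨rfl, h⟩
    · exact ⟨_, _, _, hpq, hrs, h, h0, h1⟩
    · exact ⟨_, _, _, hpq, hrs.symm, h, h0, h1.trans (swc _ _)⟩
    · exact ⟨_, _, _, hpq.symm, hrs, h, h0.trans (swc _ _), h1⟩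
    · exact ⟨_, _, _, hpq.symm, hrs.symm, h, h0.trans (swc _ _), h1.trans (swc _ _)⟩
  have step : ∀ (x y z : S6) (i j : Fin 6), x = sw i j → ∀ a b c, a ≠ b → b ≠ c → a ≠ c → i ≠ j →
      θ y = sw a b → θ z = sw b c → co y x → ¬ co z x → y ≠ x →
      ∃ d, d ≠ a ∧ d ≠ b ∧ d ≠ c ∧ θ x = sw c d := by
    rintro x y z i j rfl a b c hab hbc hac hij h0 h1 h2 h3 h4
    obtain ⟨p, q, hpq, h5⟩ := hs i j hij
    have := chain a b c p q ⟨hab, hbc, hac, hpq⟩ ⟨by rw [← h0, ← h5, key]; exact h2,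
      by rw [← h1, ← h5, key]; exact h3, by rw [← h0, ← h5]; exact fun h => h4 (θ.injective h)⟩
    rcases this with ⟨rfl, h⟩ | ⟨rfl, h⟩
    · exact ⟨q, h.1, h.2.1, h.2.2, h5⟩
    · exact ⟨p, h.1, h.2.1, h.2.2, h5.trans (swc _ _)⟩
  obtain ⟨d, hda, hdb, hdc, h2⟩ := step (sw 2 3) _ _ 2 3 rfl a b c hab hbc hac (by decide) h0 h1
    (by decide) (by decide) (by decide)
  obtain ⟨e, heb, hec, hed, h3⟩ := step (sw 3 4) _ _ 3 4 rfl b c d hbc hdc.symm hdb.symm (by decide)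
    h1 h2 (by decide) (by decide) (by decide)
  obtain ⟨f, hfc, hfd, hfe, h4⟩ := step (sw 4 5) _ _ 4 5 rfl c d e hdc.symm hed.symm hec.symm
    (by decide) h2 h3 (by decide) (by decide) (by decide)
  have hea := (apart a b d e ⟨hab, hda, hdb, hed.symm, by rw [← h0, ← h3, key]; decide⟩).1
  have hfab := apart a b e f ⟨hab, hea, heb, hfe.symm, by rw [← h0, ← h4, key]; decide⟩
  have hfa := hfab.1
  have hfb := hfab.2
  have hinj : Function.Injective ![a, b, c, d, e, f] := 
    inj6 hab.symm hac.symm hbc.symm hda hdb hdc hea heb hec hed hfa hfb hfc hfd hfe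
  let s : S6 := Equiv.ofBijective _ (Finite.injective_iff_bijective.1 hinj)
  refine ⟨s, ext_gen _ _ ?_⟩
  intro i
  rw [MulAut.conj_apply, conj_sw]
  fin_cases i
  · exact h0
  · exact h1
  · exact h2
  · exact h3
  · exact h4

theorem conj_inj : Function.Injective (MulAut.conj : S6 →* MulAut S6) := by
  rw [← MonoidHom.ker_eq_bot_iff, eq_bot_iff]
  intro s hs
  rw [Subgroup.mem_bot]
  have h1 : ∀ a b, sw (s a) (s b) = sw a b := by
    intro a b
    rw [← conj_sw, ← MulAut.conj_apply, MonoidHom.mem_ker.1 hs]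
    rfl
  ext1 a
  by_contra h
  have h : s a ≠ a := h
  obtain ⟨c, hc⟩ : ∃ c, c ≠ a ∧ c ≠ s a := third _ _
  have h2 := h1 a c
  have h3 : sw (s a) (s c) a = c := by rw [h2]; exact Equiv.swap_apply_left _ _
  by_cases h4 : a = s c
  · rw [← h4] at h3
    exact hc.2 (h3.symm.trans (Equiv.swap_apply_right _ _))
  · exact hc.1 (h3.symm.trans (Equiv.swap_apply_of_ne_of_ne h.symm h4))

theorem W_one : W 1 1 := fun _ _ _ _ => rfl

theorem W_mul {s t s' t' : S6} (h : W s t) (h' : W s' t') : W (s * s') (t * t') := fun a b i j =>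
  (h _ _ _ _).trans (h' a b i j)

theorem W_inv {s t : S6} (h : W s t) : W s⁻¹ t⁻¹ := fun a b i j => by
  rw [← h, Cl.papp, Cl.papp, Cl.papp, Cl.papp]

theorem W_symm {s t : S6} (h : W s t) : W t s := fun a b i j => by
  rw [Dsymm, h, Dsymm]

theorem W_fun1 {t : S6} (h : W 1 t) : t = 1 := by
  have h1 : ∀ i j, i ≠ j → (t i = i ∧ t j = j) ∨ (t i = j ∧ t j = i) := fun i j hij =>
    Dsep i j _ _ hij fun a b => h a b i j
  ext1 i
  by_contra hi
  have hi : t i ≠ i := hi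
  obtain ⟨k, hk⟩ : ∃ k, k ≠ i ∧ k ≠ t i := third _ _
  rcases h1 i k hk.1.symm with h2 | h2
  · exact hi h2.1
  · exact hk.2 h2.1.symm

theorem W_fun {s t t' : S6} (h : W s t) (h' : W s t') : t = t' := by
  have := W_mul (W_inv h) h'
  rw [inv_mul_cancel] at this
  exact inv_mul_eq_one.1 (W_fun1 this)

def u0 : S6 := sw 0 1 * sw 2 3 * sw 4 5

theorem W_ex (s : S6) : ∃ t, W s t := by
  have hs : s ∈ Submonoid.closure (Set.range fun i : Fin 5 => Equiv.swap i.castSucc i.succ) := by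
    rw [Equiv.Perm.mclosure_swap_castSucc_succ]; trivial
  induction hs using Submonoid.closure_induction with
  | mem x hx =>
    obtain ⟨i, rfl⟩ := hx
    fin_cases i
    · exact ⟨u0, by decide +kernel⟩
    · exact ⟨sw 0 4 * sw 1 2 * sw 3 5, by decide +kernel⟩
    · exact ⟨sw 0 1 * sw 2 5 * sw 3 4, by decide +kernel⟩
    · exact ⟨sw 0 4 * sw 1 5 * sw 2 3, by decide +kernel⟩
    · exact ⟨sw 0 1 * sw 2 4 * sw 3 5, by decide +kernel⟩
  | one => exact ⟨1, W_one⟩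
  | mul x y _ _ hx hy =>
    obtain ⟨t, ht⟩ := hx
    obtain ⟨t', ht'⟩ := hy
    exact ⟨_, W_mul ht ht'⟩

theorem alpha_ex : ∃ α : Cl.TT, ∀ s t, W s t ↔ α.1 s = t := by
  choose f hf using W_ex
  refine ⟨Cl.autOf f (fun x => W_fun (hf (f x)) (W_symm (hf x)))
    (fun x y => W_fun (hf (x * y)) (W_mul (hf x) (hf y))), ?_⟩
  intro s t
  exact ⟨fun h => W_fun (hf s) h, fun h => by rw [← h]; exact hf s⟩

theorem odd_inv {x : S6} (hs : sign x = -1) (h2 : x * x = 1) : x.IsSwap ∨ IsConj u0 x := by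
  have hct : ∀ x : S6, sign x = -1 → x * x = 1 →
      x.cycleType = Multiset.replicate 1 2 ∨ x.cycleType = Multiset.replicate 3 2 := by
    clear hs h2 x
    intro x hs h2
    have h3 : x.cycleType = Multiset.replicate x.cycleType.card 2 := by
      rw [Multiset.eq_replicate]
      refine ⟨rfl, fun n hn => ?_⟩
      have h1 := Equiv.Perm.two_le_of_mem_cycleType hn
      have h3 : n ∣ 2 := (Equiv.Perm.dvd_of_mem_cycleType hn).trans
        (orderOf_dvd_of_pow_eq_one (by rw [pow_two, h2]))
      have := Nat.le_of_dvd (by norm_num) h3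
      omega
    have hsum : x.cycleType.sum ≤ 6 := by
      rw [Equiv.Perm.sum_cycleType]
      exact (Finset.card_le_univ _).trans (by simp)
    rw [Equiv.Perm.sign_of_cycleType] at hs
    generalize x.cycleType.card = n at h3 hs
    rw [h3] at hsum hs ⊢
    simp only [Multiset.sum_replicate, smul_eq_mul] at hsum hs
    have hn : n ≤ 3 := by omega
    interval_cases n
    · exact absurd hs (by decide)
    · left; rfl
    · exact absurd hs (by decide)
    · right; rfl
  rcases hct x hs h2 with h | h
  · left
    rw [← Equiv.Perm.card_support_eq_two, ← Equiv.Perm.sum_cycleType, h]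
    rfl
  · right
    rw [Equiv.Perm.isConj_iff_cycleType_eq, h]
    rcases hct u0 (by decide) (by decide) with h' | h'
    · exfalso
      have h5 : u0.support.card = 2 := by
        rw [← Equiv.Perm.sum_cycleType, h']; rfl
      exact absurd h5 (by decide)
    · exact h'

theorem cardTT : Nat.card Cl.TT = 112 := by
  obtain ⟨⟨α, hα2⟩, hα⟩ := alpha_ex
  have hα : ∀ s t, W s t ↔ α s = t := hα
  have hu : α (sw 0 1) = u0 := (hα _ _).1 (by decide +kernel)
  have hu' : α u0 = sw 0 1 := (hα _ _).1 (by decide +kernel)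
  have hii : α⁻¹ = α := (eq_inv_of_mul_eq_one_left hα2).symm
  have hsq : ∀ s, (α * MulAut.conj s) * (α * MulAut.conj s) = MulAut.conj (α s * s) := by
    intro s
    rw [map_mul, RS.conj_mu, hii]
    group
  have hb : Function.Bijective (Sum.elim
      (fun s : {s : S6 // s * s = 1} => (⟨MulAut.conj s.1, by rw [← map_mul, s.2, map_one]⟩ : Cl.TT))
      (fun s : {s : S6 // W s s⁻¹} => ⟨α * MulAut.conj s.1, by
        rw [hsq, (hα _ _).1 s.2, inv_mul_cancel, map_one]⟩)) := by
    have hd : ∀ s t, α * MulAut.conj s ≠ MulAut.conj t := by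
      intro s t h
      have h1 : α = MulAut.conj (t * s⁻¹) := by
        rw [map_mul, ← h, map_inv]; group
      have h2 := hu
      rw [h1, MulAut.conj_apply, conj_sw] at h2
      generalize (t * s⁻¹) 0 = x at h2
      generalize (t * s⁻¹) 1 = y at h2
      revert x y
      decide
    constructor
    · rintro (a | a) (b | b) h <;> have h := congrArg Subtype.val h
      · rw [Subtype.ext (conj_inj h)]
      · exact (hd _ _ h.symm).elim
      · exact (hd _ _ h).elim
      · rw [Subtype.ext (conj_inj (mul_left_cancel (a := α) h))]
    · rintro ⟨θ, hθ⟩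
      have hcase : (∃ s, θ = MulAut.conj s) ∨ ∃ s, α * θ = MulAut.conj s := by
        rcases odd_inv (x := θ (sw 0 1)) (by rw [Cl.sign_aut]; decide) (by
          rw [← map_mul, show sw 0 1 * sw 0 1 = 1 by decide, map_one]) with h | h
        · left; exact inner_of θ h
        · right
          apply inner_of
          obtain ⟨k, hk⟩ := isConj_iff.1 h
          rw [MulAut.mul_apply, ← hk, map_mul, map_mul, hu', map_inv, conj_sw]
          exact ⟨_, _, fun h => absurd ((α k).injective h) (by decide), rfl⟩
      rcases hcase with ⟨s, hs⟩ | ⟨s, hs⟩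
      · refine ⟨Sum.inl ⟨s, ?_⟩, Subtype.ext hs.symm⟩
        apply conj_inj
        rw [map_mul, ← hs, hθ, map_one]
      · have hs' : α * MulAut.conj s = θ := by
          rw [← hs, ← mul_assoc, hα2, one_mul]
        refine ⟨Sum.inr ⟨s, ?_⟩, Subtype.ext hs'⟩
        rw [hα]
        apply eq_inv_of_mul_eq_one_left
        apply conj_inj
        rw [← hsq, hs', hθ, map_one]
  rw [← Nat.card_congr (Equiv.ofBijective _ hb), Nat.card_sum, Nat.card_eq_fintype_card,
    Nat.card_eq_fintype_card, card36, card76]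
end Ou

theorem stmt_4 :
    Nat.card {H : Subgroup (Equiv.Perm (Equiv.Perm (Fin 6))) //
      IsRegularSubgroup H ∧ IsNormalizedByLeft H} = 224 := by
  have h := Cl.count
  rw [Ou.cardTT] at h
  exact h
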